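/- Let α ≥ 1 and let η, η' be finite sequences with entries in [0,1) such that η <_lex η' (after zero-padding to equal length), and let j₀ be the least index j with η(j) < η'(j). Define k_0(m) = 2^{m+1} and k_{i+1}(m) = 2^{k_i(m)} for i, m < ω, and set k_m = k_{j₀}(m). Fix δ with 2^{η(j₀)−η'(j₀)} < δ < 1. With a_0 = 0, a_{l+1} = a_l + 1 + l·a_l and I_l = [a_l, a_{l+1}) ∩ ω, define for each U ⊆ ω: u_U(0) = 1 and, for n > 0, u_U(n) = δ·u_U(n−1) if n = k_m for some m ∈ I_l with l ∈ U, and u_U(n) = u_U(n−1) otherwise. Let φ_U : [0,1] → [0,∞) be continuous increasing with φ_U(1/2^n) = u_U(n) for every n, and set f_U(x) = x^α·φ_U(x)/l_η(x) for x ∈ (0,1] with f_U(0) = 0. Then for all U, V ⊆ ω: U ⊆* V if and only if E_{f_U} ≤_B E_{f_V}; moreover E_{Id^α/l_η} ≤_B E_{f_U} and E_{f_U} <_B E_{Id^α/l_{η'}}. -/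

import Mathlib

open Set

/-- `f` is essentially increasing on `D`: for some `C ≥ 1`,
`x ≤ y` implies `f x ≤ C * f y` for `x, y ∈ D`. -/
def EssIncOn (f : ℝ → ℝ) (D : Set ℝ) : Prop :=
  ∃ C : ℝ, 1 ≤ C ∧ ∀ x ∈ D, ∀ y ∈ D, x ≤ y → f x ≤ C * f y

/-- `(f x)_{x ∈ D} ≈ (g x)_{x ∈ D}`: for some `C ≥ 1`,
`g x / C ≤ f x ≤ C * g x` for all `x ∈ D`. -/
def EquivOn (f g : ℝ → ℝ) (D : Set ℝ) : Prop :=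
  ∃ C : ℝ, 1 ≤ C ∧ ∀ x ∈ D, g x / C ≤ f x ∧ f x ≤ C * g x

/-- `(u n) ≈ (v n)`: for some `C ≥ 1`, `v n / C ≤ u n ≤ C * v n` for all `n`. -/
def SeqEquiv (u v : ℕ → ℝ) : Prop :=
  ∃ C : ℝ, 1 ≤ C ∧ ∀ n, v n / C ≤ u n ∧ u n ≤ C * v n

/-- The relation `E_f` on `[0,1]^ω`: `(x_n) E_f (y_n)` iff `Σ f(|x_n − y_n|) < ∞`
(for `f ≥ 0` this is equivalent to summability). -/
def EF (f : ℝ → ℝ) (x y : ℕ → Icc (0:ℝ) 1) : Prop :=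
  Summable fun n => f |(x n : ℝ) - (y n : ℝ)|

/-- Borel reducibility of binary relations. -/
def BorelReducible {X Y : Type*} [MeasurableSpace X] [MeasurableSpace Y]
    (E : X → X → Prop) (F : Y → Y → Prop) : Prop :=
  ∃ θ : X → Y, Measurable θ ∧ ∀ x y, E x y ↔ F (θ x) (θ y)

/-- The relation `ℝ^ω/ℓ_p`: `x E y` iff `Σ |x_n − y_n|^p < ∞`. -/
def lpRel (p : ℝ) (x y : ℕ → ℝ) : Prop :=
  Summable fun n => |x n - y n| ^ p

/-- Mátrai's iterated-logarithm functions: `t_0(x) = 1 − log₂ x`,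
`t_{n+1}(x) = 1 + log₂(t_n(x))`. -/
noncomputable def tFun : ℕ → ℝ → ℝ
  | 0 => fun x => 1 - Real.logb 2 x
  | n+1 => fun x => 1 + Real.logb 2 (tFun n x)

/-- `l_η(x) = Π_{i<|η|} t_i(x)^{η_i}` (with `l_∅ ≡ 1`). -/
noncomputable def lFun (η : List ℝ) (x : ℝ) : ℝ :=
  ∏ i ∈ Finset.range η.length, tFun i x ^ η.getD i 0

/-- The function `Id^α/l_η`, i.e. `x ↦ x^α / l_η(x)` on `(0,1]`, with value `0` at `0`. -/
noncomputable def fEta (α : ℝ) (η : List ℝ) (x : ℝ) : ℝ :=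
  if x = 0 then 0 else x ^ α / lFun η x

/-- The towers `k_0(m) = 2^{m+1}`, `k_{i+1}(m) = 2^{k_i(m)}`. -/
def kIter : ℕ → ℕ → ℕ
  | 0, m => 2 ^ (m+1)
  | i+1, m => 2 ^ (kIter i m)

/-! ### Step functions -/

noncomputable def idx (x : ℝ) : ℕ := ⌊-Real.logb 2 x⌋₊

noncomputable def St (c : ℕ → ℝ) (x : ℝ) : ℝ := if x ≤ 0 then 0 else c (idx x)

structure Nice (K : ℝ) (c : ℕ → ℝ) : Prop where
  pos : ∀ n, 0 < c n
  half : ∀ n, 2 * c (n+1) ≤ c n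
  dbl : ∀ n, c n ≤ K * c (n+1)

theorem half_pow_eq (n : ℕ) : ((1:ℝ)/2)^n = (2:ℝ)^(-(n:ℝ)) := by
  rw [Real.rpow_neg (by norm_num), Real.rpow_natCast]; simp

theorem le_idx {x : ℝ} {n : ℕ} (hx : 0 < x) (h : x ≤ (1/2)^n) : n ≤ idx x := by
  apply Nat.le_floor
  rw [half_pow_eq] at h
  have := (Real.logb_le_iff_le_rpow (by norm_num : (1:ℝ) < 2) hx).2 h
  linarith

theorem idx_le {x : ℝ} {n : ℕ} (h : (1/2)^(n+1) < x) : idx x ≤ n := by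
  have hx : 0 < x := lt_trans (by positivity) h
  unfold idx
  rw [half_pow_eq] at h
  have := (Real.lt_logb_iff_rpow_lt (by norm_num : (1:ℝ) < 2) hx).2 h
  push_cast at this
  have h2 : ⌊-Real.logb 2 x⌋₊ < n + 1 := by
    apply (Nat.floor_lt' (by omega)).2
    push_cast; linarith
  omega

theorem idx_spec {x : ℝ} (hx : 0 < x) (hx1 : x ≤ 1) :
    (1/2)^(idx x+1) < x ∧ x ≤ (1/2)^(idx x) := by
  have h0 : 0 ≤ -Real.logb 2 x := by
    have := Real.logb_nonpos (by norm_num : (1:ℝ) < 2) hx.le hx1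
    linarith
  constructor
  · rw [half_pow_eq, ← Real.lt_logb_iff_rpow_lt (by norm_num : (1:ℝ) < 2) hx]
    have := Nat.lt_floor_add_one (-Real.logb 2 x)
    push_cast
    unfold idx
    linarith
  · rw [half_pow_eq, ← Real.logb_le_iff_le_rpow (by norm_num : (1:ℝ) < 2) hx]
    have := Nat.floor_le h0
    unfold idx
    linarith

theorem idx_lower {x : ℝ} (hx : 0 < x) : (1/2)^(idx x+1) < x := by
  rcases le_or_gt x 1 with h | h
  · exact (idx_spec hx h).1
  · refine lt_of_le_of_lt ?_ h
    exact pow_le_one₀ (by norm_num) (by norm_num)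

theorem idx_anti {x y : ℝ} (hx : 0 < x) (h : x ≤ y) : idx y ≤ idx x :=
  idx_le (lt_of_lt_of_le (idx_lower hx) h)

theorem Nice.anti {K : ℝ} {c : ℕ → ℝ} (h : Nice K c) : Antitone c :=
  antitone_nat_of_succ_le fun n => by have := h.half n; have := h.pos (n+1); linarith

theorem Nice.K_pos {K : ℝ} {c : ℕ → ℝ} (h : Nice K c) : 0 < K := by
  have h1 := h.dbl 0; have h2 := h.pos 0; have h3 := h.pos 1
  simp only [zero_add] at h1
  by_contra hk
  have : K * c 1 ≤ 0 := mul_nonpos_of_nonpos_of_nonneg (not_lt.1 hk) h3.le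
  linarith

theorem St_zero (c : ℕ → ℝ) : St c 0 = 0 := by simp [St]

theorem St_pos_eq (c : ℕ → ℝ) {x : ℝ} (hx : 0 < x) : St c x = c (idx x) := by
  simp [St, hx]

theorem Nice.St_nonneg {K : ℝ} {c : ℕ → ℝ} (h : Nice K c) (x : ℝ) : 0 ≤ St c x := by
  unfold St; split_ifs
  · exact le_rfl
  · exact (h.pos _).le

theorem Nice.St_mono {K : ℝ} {c : ℕ → ℝ} (h : Nice K c) : Monotone (St c) := by
  intro x y hxy
  rcases le_or_gt x 0 with hx | hx
  · have : St c x = 0 := by simp [St, hx]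
    rw [this]; exact h.St_nonneg y
  · rw [St_pos_eq c hx, St_pos_eq c (hx.trans_le hxy)]
    exact h.anti (idx_anti hx hxy)

theorem Nice.St_le {K : ℝ} {c : ℕ → ℝ} (h : Nice K c) {x : ℝ} {n : ℕ} (hx : x ≤ (1/2)^n) :
    St c x ≤ c n := by
  rcases le_or_gt x 0 with h0 | h0
  · simp [St, h0, (h.pos n).le]
  · rw [St_pos_eq c h0]; exact h.anti (le_idx h0 hx)

theorem Nice.St_ge {K : ℝ} {c : ℕ → ℝ} (h : Nice K c) {x : ℝ} {n : ℕ}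
    (hx : (1/2)^(n+1) < x) : c n ≤ St c x := by
  have h0 : 0 < x := lt_trans (by positivity) hx
  rw [St_pos_eq c h0]; exact h.anti (idx_le hx)

theorem Nice.St_two_mul {K : ℝ} {c : ℕ → ℝ} (h : Nice K c) (x : ℝ) :
    St c (2*x) ≤ K * St c x := by
  rcases le_or_gt x 0 with h0 | h0
  · have : 2 * x ≤ 0 := by linarith
    simp [St, h0, this]
  · rw [St_pos_eq c h0]
    rcases le_or_gt x 1 with h1 | h1
    · have h2 := (idx_spec h0 h1).2
      rcases hn : idx x with _ | n
      · rw [St_pos_eq c (by linarith)]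
        have h3 := h.anti (Nat.zero_le (idx (2*x)))
        have h4 := h.dbl 0
        have h5 : c 1 ≤ c 0 := h.anti (by norm_num)
        have := mul_le_mul_of_nonneg_left h5 h.K_pos.le
        simp only [zero_add] at h4
        linarith
      · rw [hn] at h2
        refine (h.St_le (n := n) ?_).trans (h.dbl n)
        rw [pow_succ] at h2; linarith
    · have h2 : idx x ≤ 0 := idx_le (by norm_num; linarith)
      rw [St_pos_eq c (by linarith), Nat.le_zero.1 h2]
      have h3 := h.anti (Nat.zero_le (idx (2*x)))
      have h4 := h.dbl 0
      have h5 : c 1 ≤ c 0 := h.anti (by norm_num)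
      have := mul_le_mul_of_nonneg_left h5 h.K_pos.le
      simp only [zero_add] at h4
      linarith

theorem Nice.St_add {K : ℝ} {c : ℕ → ℝ} (h : Nice K c) (x y : ℝ) :
    St c (x + y) ≤ K * (St c x + St c y) := by
  rcases le_total x y with hxy | hxy
  · refine (h.St_mono (by linarith : x + y ≤ 2 * y)).trans ((h.St_two_mul y).trans ?_)
    have := h.St_nonneg x
    exact mul_le_mul_of_nonneg_left (by linarith) h.K_pos.le
  · refine (h.St_mono (by linarith : x + y ≤ 2 * x)).trans ((h.St_two_mul x).trans ?_)
    have := h.St_nonneg y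
    exact mul_le_mul_of_nonneg_left (by linarith) h.K_pos.le

theorem Nice.St_tri {K : ℝ} {c : ℕ → ℝ} (h : Nice K c) (x y z : ℝ) :
    St c |x - z| ≤ K * (St c |x - y| + St c |y - z|) :=
  (h.St_mono (abs_sub_le x y z)).trans (h.St_add _ _)

/-- `EF` only depends on `f` up to comparability on `[0,1]`. -/
theorem EF_congr {f g : ℝ → ℝ} {C : ℝ}
    (hf : ∀ x ∈ Icc (0:ℝ) 1, 0 ≤ f x) (hg : ∀ x ∈ Icc (0:ℝ) 1, 0 ≤ g x)
    (h1 : ∀ x ∈ Icc (0:ℝ) 1, f x ≤ C * g x) (h2 : ∀ x ∈ Icc (0:ℝ) 1, g x ≤ C * f x) :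
    EF f = EF g := by
  have key : ∀ a b : Icc (0:ℝ) 1, |(a:ℝ) - b| ∈ Icc (0:ℝ) 1 := by
    intro a b
    refine ⟨abs_nonneg _, abs_le.2 ⟨?_, ?_⟩⟩ <;> linarith [a.2.1, a.2.2, b.2.1, b.2.2]
  funext x y
  apply propext
  unfold EF
  constructor
  · intro hs
    exact Summable.of_nonneg_of_le (fun n => hg _ (key _ _)) (fun n => h2 _ (key _ _))
      (hs.mul_left C)
  · intro hs
    exact Summable.of_nonneg_of_le (fun n => hf _ (key _ _)) (fun n => h1 _ (key _ _))
      (hs.mul_left C)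

/-! ### The reduction lemma -/

theorem chord_lower {a b : ℝ} (h : |a - b| ≤ 1) :
    |a - b| / 2 ≤ |Real.cos a - Real.cos b| ∨ |a - b| / 2 ≤ |Real.sin a - Real.sin b| := by
  by_contra hcon
  push Not at hcon
  obtain ⟨h1, h2⟩ := hcon
  set D := |a - b| with hD
  have hD0 : 0 ≤ D := abs_nonneg _
  have e1 : (Real.cos a - Real.cos b)^2 < (D/2)^2 := by
    rw [← sq_abs]; exact pow_lt_pow_left₀ h1 (abs_nonneg _) (by norm_num)
  have e2 : (Real.sin a - Real.sin b)^2 < (D/2)^2 := by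
    rw [← sq_abs]; exact pow_lt_pow_left₀ h2 (abs_nonneg _) (by norm_num)
  have e3 : (Real.cos a - Real.cos b)^2 + (Real.sin a - Real.sin b)^2 = 2 - 2 * Real.cos D := by
    rw [hD, Real.cos_abs, Real.cos_sub]
    nlinarith [Real.sin_sq_add_cos_sq a, Real.sin_sq_add_cos_sq b]
  have e4 := Real.cos_bound (x := D) (by rw [abs_of_nonneg hD0]; exact h)
  rw [abs_of_nonneg hD0] at e4
  have e5 := (abs_le.1 e4).2
  have e6 : D^4 ≤ D^2 := pow_le_pow_of_le_one hD0 h (by norm_num)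
  nlinarith [sq_nonneg D]

/-- The level-`i` coordinates. -/
noncomputable def wav (b : Bool) (t : ℝ) : ℝ := if b then Real.cos t else Real.sin t

theorem wav_abs (b : Bool) (t : ℝ) : |wav b t| ≤ 1 := by
  unfold wav; split_ifs
  · exact Real.abs_cos_le_one t
  · exact Real.abs_sin_le_one t

theorem wav_lip (b : Bool) (s t : ℝ) : |wav b s - wav b t| ≤ |s - t| := by
  unfold wav; split_ifs
  · have := Real.lipschitzWith_cos.dist_le_mul s t
    simpa [Real.dist_eq] using this
  · have := Real.lipschitzWith_sin.dist_le_mul s t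
    simpa [Real.dist_eq] using this

theorem wav_cont (b : Bool) : Continuous (wav b) := by
  cases b
  · have : wav false = Real.sin := by funext t; simp [wav]
    rw [this]; exact Real.continuous_sin
  · have : wav true = Real.cos := by funext t; simp [wav]
    rw [this]; exact Real.continuous_cos

def jmp (e : ℕ → ℕ) (i : ℕ) : Prop := i = 0 ∨ e (i-1) < e i

open Classical in
noncomputable def coo (e : ℕ → ℕ) (p : ℕ × Bool) (x : ℝ) : ℝ :=
  if jmp e p.1 then (1/2)^(p.1 - e p.1) * ((1 + wav p.2 (2^p.1 * x)) / 2) else 0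

theorem coo_mem (e : ℕ → ℕ) (p : ℕ × Bool) (x : ℝ) : coo e p x ∈ Icc (0:ℝ) 1 := by
  unfold coo
  have h := abs_le.1 (wav_abs p.2 (2^p.1 * x))
  split_ifs
  · constructor
    · apply mul_nonneg (by positivity); linarith
    · apply mul_le_one₀ (pow_le_one₀ (by norm_num) (by norm_num)) <;> linarith
  · simp

theorem coo_cont (e : ℕ → ℕ) (p : ℕ × Bool) : Continuous (coo e p) := by
  unfold coo
  split_ifs
  · have := wav_cont p.2
    fun_prop
  · exact continuous_const

open Classical in
noncomputable def hbd (d : ℕ → ℝ) (e : ℕ → ℕ) (n i : ℕ) : ℝ :=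
  if jmp e i then (if i ≤ n then d (n - e i) else d (i - e i)) else 0

theorem hbd_sum1 {K : ℝ} {d : ℕ → ℝ} {e : ℕ → ℕ} (hd : Nice K d) (he : Monotone e)
    (hei : ∀ n, e n ≤ n) (n : ℕ) : ∀ N ≤ n, ∑ i ∈ Finset.range (N+1), hbd d e n i ≤ 2 * d (n - e N) := by
  intro N
  induction N with
  | zero =>
    intro _
    have := hd.pos (n - e 0)
    simp [hbd, jmp]; linarith
  | succ N ih =>
    intro hN
    rw [Finset.sum_range_succ]
    have ih' := ih (by omega)
    unfold hbd at ih' ⊢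
    by_cases hj : jmp e (N+1)
    · have hlt : e N < e (N+1) := by simpa [jmp] using hj
      have h1 : 2 * d (n - e N) ≤ d (n - e (N+1)) := by
        have h2 := hd.half (n - e (N+1))
        have h3 : d (n - e N) ≤ d (n - e (N+1) + 1) := hd.anti (by have := hei (N+1); omega)
        linarith
      simp only [hj, hN, if_true] at *
      linarith
    · have hle : e N ≤ e (N+1) := he (by omega)
      have heq : e (N+1) = e N := by
        simp [jmp] at hj; omega
      simp only [hj, if_false, heq]
      linarith

theorem hbd_sum2 {K K' : ℝ} {c d : ℕ → ℝ} {e : ℕ → ℕ} (hd : Nice K d) (hc : Nice K' c)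
    (he : Monotone e) (hei : ∀ n, e n ≤ n) {C : ℝ} (hC : 0 ≤ C)
    (h2 : ∀ n, d (n - e n) ≤ C * c n) (n : ℕ) (M : ℕ) :
    ∑ i ∈ Finset.range (n + 1 + M), hbd d e n i ≤ 2 * d (n - e n) + C * (c n - c (n+M)) := by
  induction M with
  | zero => simpa using hbd_sum1 hd he hei n n le_rfl
  | succ M ih =>
    rw [show n + 1 + (M+1) = (n+1+M)+1 by ring, Finset.sum_range_succ]
    have h3 : hbd d e n (n+1+M) ≤ C * c (n+1+M) := by
      unfold hbd
      split_ifs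
      · omega
      · exact h2 _
      · exact mul_nonneg hC (hc.pos _).le
    have h4 := hc.half (n+M)
    rw [show n + M + 1 = n+1+M by ring] at h4
    rw [show n + (M + 1) = n+1+M by ring]
    have h5 : C * c (n+1+M) ≤ C * (c (n+M) - c (n+1+M)) :=
      mul_le_mul_of_nonneg_left (by linarith) hC
    nlinarith

theorem hbd_nonneg {K : ℝ} {d : ℕ → ℝ} (hd : Nice K d) (e : ℕ → ℕ) (n i : ℕ) : 0 ≤ hbd d e n i := by
  unfold hbd; split_ifs
  · exact (hd.pos _).le
  · exact (hd.pos _).le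
  · exact le_rfl

theorem coo_le {K : ℝ} {d : ℕ → ℝ} {e : ℕ → ℕ} (hd : Nice K d) (hei : ∀ n, e n ≤ n)
    (p : ℕ × Bool) {x y : ℝ} {n : ℕ} (hxy : |x - y| ≤ (1/2)^n) :
    St d |coo e p x - coo e p y| ≤ hbd d e n p.1 := by
  unfold coo hbd
  by_cases hj : jmp e p.1
  · simp only [hj, if_true]
    have heq : (1/2:ℝ)^(p.1 - e p.1) * ((1 + wav p.2 (2^p.1 * x)) / 2) -
        (1/2)^(p.1 - e p.1) * ((1 + wav p.2 (2^p.1 * y)) / 2) =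
        (1/2)^(p.1 - e p.1) * ((wav p.2 (2^p.1 * x) - wav p.2 (2^p.1 * y)) / 2) := by ring
    rw [heq, abs_mul, abs_of_nonneg (by positivity : (0:ℝ) ≤ (1/2)^(p.1 - e p.1)), abs_div,
      abs_of_nonneg (by norm_num : (0:ℝ) ≤ 2)]
    split_ifs with hi
    · apply hd.St_le
      have h1 := wav_lip p.2 (2^p.1 * x) (2^p.1 * y)
      rw [← mul_sub, abs_mul, abs_of_nonneg (by positivity : (0:ℝ) ≤ 2^p.1)] at h1
      have h2 : |wav p.2 (2^p.1 * x) - wav p.2 (2^p.1 * y)| / 2 ≤ 2^p.1 * (1/2)^n := by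
        have : (2:ℝ)^p.1 * |x - y| ≤ 2^p.1 * (1/2)^n := by gcongr
        have := abs_nonneg (wav p.2 (2^p.1 * x) - wav p.2 (2^p.1 * y))
        linarith
      refine (mul_le_mul_of_nonneg_left h2 (by positivity)).trans (le_of_eq ?_)
      have h3 := hei p.1
      obtain ⟨k, hk⟩ := Nat.exists_eq_add_of_le h3
      obtain ⟨l, hl⟩ := Nat.exists_eq_add_of_le hi
      have e1 : p.1 - e p.1 = k := by omega
      have e2 : n - e p.1 = k + l := by omega
      rw [e1, e2, hl, pow_add (1/2:ℝ) p.1 l, ← mul_assoc ((2:ℝ)^p.1), ← mul_pow]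
      rw [pow_add]; norm_num
    · apply hd.St_le
      have h1 := abs_sub (wav p.2 (2^p.1 * x)) (wav p.2 (2^p.1 * y))
      have h2 := wav_abs p.2 (2^p.1 * x)
      have h3 := wav_abs p.2 (2^p.1 * y)
      have : |wav p.2 (2^p.1 * x) - wav p.2 (2^p.1 * y)| / 2 ≤ 1 := by linarith
      exact mul_le_of_le_one_right (by positivity) this
  · simp [hj, St]

theorem exists_last_jump {e : ℕ → ℕ} (he : Monotone e) (n : ℕ) :
    ∃ i ≤ n, jmp e i ∧ e i = e n := by
  induction n with
  | zero => exact ⟨0, le_rfl, Or.inl rfl, rfl⟩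
  | succ n ih =>
    by_cases hj : jmp e (n+1)
    · exact ⟨n+1, le_rfl, hj, rfl⟩
    · obtain ⟨i, hi, hji, hei⟩ := ih
      have hle : e n ≤ e (n+1) := he (by omega)
      have heq : e (n+1) = e n := by
        simp [jmp] at hj; omega
      exact ⟨i, by omega, hji, by omega⟩

theorem coo_ge {K : ℝ} {d : ℕ → ℝ} {e : ℕ → ℕ} (hd : Nice K d) (he : Monotone e)
    (hei : ∀ n, e n ≤ n) {x y : ℝ} {n : ℕ} (hxy : |x - y| ≤ (1/2)^n)
    (hxy2 : (1/2)^(n+1) < |x - y|) :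
    ∃ p : ℕ × Bool, d (n - e n) ≤ K^2 * St d |coo e p x - coo e p y| := by
  obtain ⟨i, hi, hj, hee⟩ := exists_last_jump he n
  have key : ∃ b, |(2:ℝ)^i * x - 2^i * y| / 2 ≤ |wav b (2^i * x) - wav b (2^i * y)| := by
    have : |(2:ℝ)^i * x - 2^i * y| ≤ 1 := by
      rw [← mul_sub, abs_mul, abs_of_nonneg (by positivity : (0:ℝ) ≤ 2^i)]
      calc (2:ℝ)^i * |x - y| ≤ 2^i * (1/2)^i := by
            gcongr
            exact hxy.trans (pow_le_pow_of_le_one (by norm_num) (by norm_num) hi)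
        _ = 1 := by rw [← mul_pow]; norm_num
    rcases chord_lower this with h | h
    · exact ⟨true, by simpa [wav] using h⟩
    · exact ⟨false, by simpa [wav] using h⟩
  obtain ⟨b, hb⟩ := key
  refine ⟨(i,b), ?_⟩
  have h1 : (1/2:ℝ)^((n - e n + 2) + 1) < |coo e (i,b) x - coo e (i,b) y| := by
    unfold coo
    simp only [hj, if_true]
    have heq : (1/2:ℝ)^(i - e i) * ((1 + wav b (2^i * x)) / 2) -
        (1/2)^(i - e i) * ((1 + wav b (2^i * y)) / 2) =
        (1/2)^(i - e i) * ((wav b (2^i * x) - wav b (2^i * y)) / 2) := by ring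
    rw [heq, abs_mul, abs_of_nonneg (by positivity : (0:ℝ) ≤ (1/2)^(i - e i)), abs_div,
      abs_of_nonneg (by norm_num : (0:ℝ) ≤ 2)]
    rw [← mul_sub, abs_mul, abs_of_nonneg (by positivity : (0:ℝ) ≤ 2^i)] at hb
    have h2 : (2:ℝ)^i * (1/2)^(n+1) / 4 < |wav b (2^i * x) - wav b (2^i * y)| / 2 := by
      have : (2:ℝ)^i * (1/2)^(n+1) < 2^i * |x-y| := by gcongr
      linarith
    refine lt_of_eq_of_lt ?_ (mul_lt_mul_of_pos_left h2 (by positivity))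
    have h3 := hei i
    obtain ⟨k, hk⟩ := Nat.exists_eq_add_of_le h3
    obtain ⟨l, hl⟩ := Nat.exists_eq_add_of_le hi
    have e1 : i - e i = k := by omega
    have e2 : n - e n + 2 + 1 = k + (l + 1) + 2 := by omega
    have e3 : n + 1 = i + (l+1) := by omega
    rw [e1, e2, e3, pow_add (1/2:ℝ) i, ← mul_assoc ((2:ℝ)^i), ← mul_pow]
    rw [pow_add _ _ 2, pow_add]; norm_num; ring
  have h2 := hd.St_ge h1
  have h3 := hd.dbl (n - e n)
  have h4 := hd.dbl (n - e n + 1)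
  have hK := hd.K_pos
  calc d (n - e n) ≤ K * d (n - e n + 1) := h3
    _ ≤ K * (K * d (n - e n + 1 + 1)) := by gcongr
    _ = K^2 * d (n - e n + 2) := by ring_nf
    _ ≤ _ := by gcongr

theorem reduction {K : ℝ} {c d : ℕ → ℝ} (hc : Nice K c) (hd : Nice K d) (e : ℕ → ℕ)
    (he : Monotone e) (hei : ∀ n, e n ≤ n) {C : ℝ} (hC : 0 ≤ C)
    (h1 : ∀ n, c n ≤ C * d (n - e n)) (h2 : ∀ n, d (n - e n) ≤ C * c n) :
    BorelReducible (EF (St c)) (EF (St d)) := by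
  have key : ∀ a b : Icc (0:ℝ) 1, |(a:ℝ) - b| ≤ 1 := by
    intro a b
    refine abs_le.2 ⟨?_, ?_⟩ <;> linarith [a.2.1, a.2.2, b.2.1, b.2.2]
  obtain ⟨eq⟩ : Nonempty (ℕ ≃ ℕ × (ℕ × Bool)) := nonempty_equiv_of_countable
  let θ : (ℕ → Icc (0:ℝ) 1) → (ℕ → Icc (0:ℝ) 1) := fun x m =>
    ⟨coo e (eq m).2 (x (eq m).1), coo_mem _ _ _⟩
  refine ⟨θ, ?_, ?_⟩
  · apply measurable_pi_lambda
    intro m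
    apply Measurable.subtype_mk
    exact (coo_cont e _).measurable.comp (measurable_subtype_coe.comp (measurable_pi_apply _))
  intro x y
  let F : ℕ × (ℕ × Bool) → ℝ := fun q => St d |coo e q.2 (x q.1) - coo e q.2 (y q.1)|
  have hFn : 0 ≤ F := fun q => hd.St_nonneg _
  have hE : EF (St d) (θ x) (θ y) ↔ Summable F := by
    unfold EF
    rw [← eq.summable_iff (f := F)]
    rfl
  rw [hE]
  set B : ℝ := 2 * (2 * C + C) with hB
  have bound : ∀ k, Summable (fun p => F (k,p)) ∧
      ∑' p, F (k,p) ≤ B * St c |(x k:ℝ) - y k| := by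
    intro k
    rcases (abs_nonneg ((x k:ℝ) - y k)).eq_or_lt with h0 | h0
    · have : (x k:ℝ) = y k := by rw [← sub_eq_zero]; exact abs_eq_zero.1 h0.symm
      have hz : (fun p => F (k,p)) = fun _ => 0 := by
        funext p; simp [F, this, St]
      rw [hz]
      refine ⟨summable_zero, ?_⟩
      simp [this, St]
    · obtain ⟨s1, s2⟩ := idx_spec h0 (key _ _)
      set n := idx |(x k:ℝ) - y k| with hn
      have hle : ∀ p, F (k,p) ≤ hbd d e n p.1 := fun p => coo_le hd hei p s2
      have hs : ∀ N, ∑ i ∈ Finset.range N, hbd d e n i ≤ (2 * C + C) * c n := by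
        intro N
        have h3 : ∑ i ∈ Finset.range N, hbd d e n i ≤ ∑ i ∈ Finset.range (n+1+N), hbd d e n i :=
          Finset.sum_le_sum_of_subset_of_nonneg (Finset.range_mono (by omega))
            (fun i _ _ => hbd_nonneg hd e n i)
        have h4 := hbd_sum2 hd hc he hei hC h2 n N
        have h5 := h2 n
        have h6 := mul_nonneg hC (hc.pos (n+N)).le
        nlinarith
      have hsum : Summable (hbd d e n) := summable_of_sum_range_le (hbd_nonneg hd e n) hs
      have hts : ∑' i, hbd d e n i ≤ (2 * C + C) * c n :=
        hsum.tsum_le_of_sum_range_le hs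
      have hprod : Summable (fun p : ℕ × Bool => hbd d e n p.1) := by
        rw [summable_prod_of_nonneg (fun p => hbd_nonneg hd e n p.1)]
        refine ⟨fun i => Summable.of_finite, ?_⟩
        simp only [tsum_fintype]
        simpa using hsum.mul_left 2
      have hSF : Summable (fun p => F (k,p)) :=
        Summable.of_nonneg_of_le (fun p => hFn _) hle hprod
      refine ⟨hSF, (hSF.tsum_le_tsum hle hprod).trans ?_⟩
      rw [hprod.tsum_prod]
      simp only [tsum_fintype]
      rw [St_pos_eq c h0, ← hn]
      simp only [Finset.sum_const, Finset.card_univ, Fintype.card_bool, nsmul_eq_mul]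
      rw [tsum_mul_left]
      push_cast
      nlinarith
  have lower : ∀ k, St c |(x k:ℝ) - y k| ≤ C * K^2 * ∑' p, F (k,p) := by
    intro k
    rcases (abs_nonneg ((x k:ℝ) - y k)).eq_or_lt with h0 | h0
    · rw [← h0, St_zero]
      exact mul_nonneg (by positivity) (tsum_nonneg fun p => hFn _)
    · obtain ⟨s1, s2⟩ := idx_spec h0 (key _ _)
      set n := idx |(x k:ℝ) - y k| with hn
      obtain ⟨p, hp⟩ := coo_ge hd he hei s2 s1
      rw [St_pos_eq c h0, ← hn]
      have h3 : F (k,p) ≤ ∑' p, F (k,p) := (bound k).1.le_tsum p (fun q _ => hFn _)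
      calc c n ≤ C * d (n - e n) := h1 n
        _ ≤ C * (K^2 * F (k,p)) := by gcongr
        _ ≤ C * (K^2 * ∑' p, F (k,p)) := by gcongr
        _ = _ := by ring
  rw [summable_prod_of_nonneg hFn]
  constructor
  · intro hs
    refine ⟨fun k => (bound k).1, ?_⟩
    exact Summable.of_nonneg_of_le (fun k => tsum_nonneg fun p => hFn _)
      (fun k => (bound k).2) (hs.mul_left B)
  · rintro ⟨-, hs⟩
    exact Summable.of_nonneg_of_le (fun k => hc.St_nonneg _) lower (hs.mul_left _)

/-! ### Category argument: decomposition of a Borel reduction -/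

def Cyl (s : List ℕ) : Set (ℕ → ℕ) := {x | ∀ p a, s[p]? = some a → x p = a}

def ov (s : List ℕ) (x : ℕ → ℕ) : ℕ → ℕ := fun p => (s[p]?).getD (x p)

theorem ov_mem_Cyl (s : List ℕ) (x : ℕ → ℕ) : ov s x ∈ Cyl s := by
  intro p a h; simp [ov, h]

theorem Cyl_append_subset (s r : List ℕ) : Cyl (s ++ r) ⊆ Cyl s := by
  intro x hx p a h
  apply hx p a
  have hp : p < s.length := by
    by_contra hc
    rw [List.getElem?_eq_none (by omega)] at h
    exact absurd h (by simp)
  rw [List.getElem?_append_left hp]; exact h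

theorem isOpen_Cyl (s : List ℕ) : IsOpen (Cyl s) := by
  have : Cyl s = ⋂ p ∈ Finset.range s.length, {x : ℕ → ℕ | ∀ a, s[p]? = some a → x p = a} := by
    ext x
    simp only [Cyl, mem_ofPred_eq, mem_iInter, Finset.mem_range]
    constructor
    · intro h p _ a; exact h p a
    · intro h p a hpa
      refine h p ?_ a hpa
      by_contra hc
      rw [List.getElem?_eq_none (by omega)] at hpa
      exact absurd hpa (by simp)
  rw [this]
  apply isOpen_biInter_finset
  intro p _
  have hc : Continuous (fun x : ℕ → ℕ => x p) := continuous_apply p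
  have h2 := (isOpen_discrete {b : ℕ | ∀ a, s[p]? = some a → b = a}).preimage hc
  exact h2

theorem exists_Cyl_subset {U : Set (ℕ → ℕ)} (hU : IsOpen U) {x : ℕ → ℕ} (hx : x ∈ U)
    {s : List ℕ} (hs : x ∈ Cyl s) : ∃ r, x ∈ Cyl (s ++ r) ∧ Cyl (s ++ r) ⊆ U := by
  obtain ⟨V, ⟨y, n, rfl⟩, hxV, hVU⟩ :=
    (PiNat.isTopologicalBasis_cylinders (fun _ : ℕ => ℕ)).exists_subset_of_mem_open hx hU
  refine ⟨(List.range n).map (fun p => x (s.length + p)), ?_, ?_⟩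
  · intro p a h
    rcases lt_or_ge p s.length with hp | hp
    · rw [List.getElem?_append_left hp] at h
      exact hs p a h
    · rw [List.getElem?_append_right hp] at h
      simp only [List.getElem?_map, Option.map_eq_some_iff] at h
      obtain ⟨b, hb, rfl⟩ := h
      rw [List.getElem?_eq_some_iff] at hb
      obtain ⟨h1, h2⟩ := hb
      simp at h2
      congr 1; omega
  · intro z hz
    apply hVU
    rw [PiNat.mem_cylinder_iff] at hxV ⊢
    intro p hp
    rw [← hxV p hp]
    rcases lt_or_ge p s.length with hps | hps
    · have h1 := Cyl_append_subset _ _ hz p s[p] (by simp [hps])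
      have h2 := hs p s[p] (by simp [hps])
      rw [h1, h2]
    · apply hz p
      rw [List.getElem?_append_right hps]
      simp only [List.getElem?_map, Option.map_eq_some_iff]
      refine ⟨p - s.length, ?_, by congr 1; omega⟩
      rw [List.getElem?_eq_some_iff]
      exact ⟨by simp; omega, by simp⟩

theorem exists_generic {ι : Type*} [Countable ι] (D : ι → Set (ℕ → ℕ))
    (hD : ∀ j, MeasurableSet (D j)) :
    ∃ O : ℕ → Set (ℕ → ℕ), (∀ n, IsOpen (O n)) ∧ Dense (⋂ n, O n) ∧
      ∃ W : ι → Set (ℕ → ℕ), (∀ j, IsOpen (W j)) ∧ ∀ x ∈ ⋂ n, O n, ∀ j, x ∈ D j ↔ x ∈ W j := by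
  have h : ∀ j, ∃ W : Set (ℕ → ℕ), IsOpen W ∧ D j =ᶠ[residual _] W :=
    fun j => (hD j).residualEq_isOpen
  choose W hW1 hW2 using h
  have h2 : ∀ᶠ x in residual (ℕ → ℕ), ∀ j, x ∈ D j ↔ x ∈ W j := by
    rw [eventually_countable_forall]
    intro j
    exact (hW2 j).mem_iff
  obtain ⟨t, ht, hG, htd⟩ := mem_residual.1 h2
  obtain ⟨O, hO, rfl⟩ := isGδ_iff_eq_iInter_nat.1 hG
  exact ⟨O, hO, htd, W, hW1, fun x hx j => ht hx j⟩

theorem common_ext {ι : Type*} (D : ι → List ℕ → Prop) (J : Finset ι)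
    (h1 : ∀ j ∈ J, ∀ r, ∃ r', D j (r ++ r')) (h2 : ∀ j ∈ J, ∀ r r', D j r → D j (r ++ r'))
    (r0 : List ℕ) : ∃ r', ∀ j ∈ J, D j (r0 ++ r') := by
  classical
  induction J using Finset.induction_on generalizing r0 with
  | empty => exact ⟨[], by simp⟩
  | insert j J hj ih =>
    obtain ⟨r1, hr1⟩ := ih (fun i hi => h1 i (Finset.mem_insert_of_mem hi))
      (fun i hi => h2 i (Finset.mem_insert_of_mem hi)) r0
    obtain ⟨r2, hr2⟩ := h1 j (Finset.mem_insert_self _ _) (r0 ++ r1)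
    refine ⟨r1 ++ r2, ?_⟩
    intro i hi
    rw [← List.append_assoc]
    rcases Finset.mem_insert.1 hi with rfl | hi'
    · exact hr2
    · exact h2 i hi _ _ (hr1 i hi')

theorem tail_small {h : ℕ → ℝ} (h0 : ∀ k, 0 ≤ h k) (hs : Summable h) {ε : ℝ} (hε : 0 < ε) :
    ∃ N, ∀ M, ∑ k ∈ Finset.Ico N M, h k ≤ ε := by
  have ht := hs.hasSum.tendsto_sum_nat
  have := (ht.eventually (lt_mem_nhds (by linarith : ∑' k, h k - ε < ∑' k, h k))).exists
  obtain ⟨N, hN⟩ := this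
  refine ⟨N, fun M => ?_⟩
  rcases le_or_gt N M with hNM | hNM
  · have h1 := Finset.sum_range_add_sum_Ico h hNM
    have h2 := hs.sum_le_tsum (Finset.range M) (fun k _ => h0 k)
    linarith
  · rw [Finset.Ico_eq_empty (by omega)]; simpa using hε.le

structure Gauge (K : ℝ) (g : ℝ → ℝ) : Prop where
  Kpos : 0 < K
  meas : Measurable g
  nonneg : ∀ t, 0 ≤ g t
  zero : g 0 = 0
  tri : ∀ x y z : ℝ, g |x - z| ≤ K * (g |x - y| + g |y - z|)
  small : ∀ ε > 0, ∃ η > 0, ∀ t : ℝ, |t| < η → g |t| ≤ ε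

theorem step_exists {K : ℝ} {g : ℝ → ℝ} (hg : Gauge K g) (Θ : (ℕ → ℕ) → ℕ → ℝ)
    (hΘ : ∀ k, Measurable fun x => Θ x k)
    (Hfin : ∀ x s, Summable fun k => g |Θ x k - Θ (ov s x) k|) :
    ∃ (O : ℕ → Set (ℕ → ℕ)), ∀ (S : Finset (List ℕ)) (i Np : ℕ), ∃ (r : List ℕ) (N : ℕ), Np < N ∧
      ∀ s ∈ S, Cyl (s ++ r) ⊆ O i ∧
        (∀ s' ∈ S, ∀ x ∈ (⋂ n, O n) ∩ Cyl (s ++ r), ∀ M,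
          ∑ k ∈ Finset.Ico N M, g |Θ x k - Θ (ov s' x) k| ≤ (1/2)^i) ∧
        (∀ x ∈ (⋂ n, O n) ∩ Cyl (s ++ r), ∀ y ∈ (⋂ n, O n) ∩ Cyl (s ++ r),
          ∑ k ∈ Finset.range N, g |Θ x k - Θ y k| ≤ (1/2)^i) := by
  classical
  have hov : ∀ s, Measurable (ov s) := by
    intro s
    apply measurable_pi_lambda
    intro p
    unfold ov
    cases s[p]? with
    | none => exact measurable_pi_apply p
    | some a => exact measurable_const
  let D : (List ℕ × ℕ × ℕ) ⊕ (ℕ × ℚ × ℕ) → Set (ℕ → ℕ) := fun j => match j with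
    | Sum.inl (s, N, i) => {x | ∀ M, ∑ k ∈ Finset.Ico N M, g |Θ x k - Θ (ov s x) k| ≤ (1/2)^i}
    | Sum.inr (k, q, j) => {x | |Θ x k - (q:ℝ)| < 1/((j:ℝ)+1)}
  have hD : ∀ j, MeasurableSet (D j) := by
    rintro (⟨s, N, i⟩ | ⟨k, q, j⟩)
    · have : D (Sum.inl (s, N, i)) =
          ⋂ M, {x | ∑ k ∈ Finset.Ico N M, g |Θ x k - Θ (ov s x) k| ≤ (1/2)^i} := by
        ext x; simp [D]
      rw [this]
      apply MeasurableSet.iInter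
      intro M
      apply measurableSet_le _ measurable_const
      apply Finset.measurable_sum
      intro k _
      have h1 : Measurable fun x => Θ (ov s x) k := (hΘ k).comp (hov s)
      have h2 : Measurable fun x => |Θ x k - Θ (ov s x) k| := ((hΘ k).sub h1).abs
      exact hg.meas.comp h2
    · apply measurableSet_lt _ measurable_const
      exact ((hΘ k).sub measurable_const).abs
  obtain ⟨O, hO, hdense, W, hW, hGW⟩ := exists_generic D hD
  refine ⟨O, ?_⟩
  intro S i Np
  -- generic points in cylinders
  have gen : ∀ s, ∃ x, x ∈ (⋂ n, O n) ∧ x ∈ Cyl s := by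
    intro s
    obtain ⟨x, hx1, hx2⟩ := hdense.inter_open_nonempty (Cyl s) (isOpen_Cyl s)
      ⟨_, ov_mem_Cyl s (fun _ => 0)⟩
    exact ⟨x, hx2, hx1⟩
  -- (a), (b)
  obtain ⟨r1, hr1⟩ := common_ext (ι := List ℕ × List ℕ)
    (fun j r => Cyl (j.1 ++ r) ⊆ O i ∧ ∃ N, ∀ x ∈ (⋂ n, O n) ∩ Cyl (j.1 ++ r), ∀ M,
          ∑ k ∈ Finset.Ico N M, g |Θ x k - Θ (ov j.2 x) k| ≤ (1/2)^i) (S ×ˢ S)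
    (by
      rintro ⟨s, s'⟩ _ r
      obtain ⟨x, hxG, hxC⟩ := gen (s ++ r)
      obtain ⟨N, hN⟩ := tail_small (fun k => hg.nonneg _) (Hfin x s')
        (by positivity : (0:ℝ) < (1/2)^i)
      have hxD : x ∈ D (Sum.inl (s', N, i)) := hN
      have hxW := (hGW x hxG (Sum.inl (s', N, i))).1 hxD
      have hxO : x ∈ O i := mem_iInter.1 hxG i
      obtain ⟨r', _, hr'⟩ := exists_Cyl_subset ((hW (Sum.inl (s', N, i))).inter (hO i)) ⟨hxW, hxO⟩ hxC
      refine ⟨r', ?_, N, ?_⟩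
      · rw [← List.append_assoc]; exact fun y hy => (hr' hy).2
      · rw [← List.append_assoc]
        rintro y ⟨hyG, hyC⟩
        exact (hGW y hyG (Sum.inl (s', N, i))).2 (hr' hyC).1)
    (by
      rintro ⟨s, s'⟩ _ r r' ⟨h1, N, h2⟩
      have hsub : Cyl (s ++ (r ++ r')) ⊆ Cyl (s ++ r) := by
        rw [← List.append_assoc]; exact Cyl_append_subset _ _
      exact ⟨hsub.trans h1, N, fun x hx => h2 x ⟨hx.1, hsub hx.2⟩⟩) []
  simp only [List.nil_append] at hr1
  have hN' : ∃ N, Np < N ∧ ∀ s ∈ S, ∀ s' ∈ S, ∀ x ∈ (⋂ n, O n) ∩ Cyl (s ++ r1), ∀ M,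
          ∑ k ∈ Finset.Ico N M, g |Θ x k - Θ (ov s' x) k| ≤ (1/2)^i := by
    have : ∀ j : List ℕ × List ℕ, ∃ N, j ∈ S ×ˢ S → ∀ x ∈ (⋂ n, O n) ∩ Cyl (j.1 ++ r1), ∀ M,
          ∑ k ∈ Finset.Ico N M, g |Θ x k - Θ (ov j.2 x) k| ≤ (1/2)^i := by
      intro j
      by_cases hj : j ∈ S ×ˢ S
      · obtain ⟨_, N, hN⟩ := hr1 j hj
        exact ⟨N, fun _ => hN⟩
      · exact ⟨0, fun h => absurd h hj⟩
    choose Nf hNf using this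
    refine ⟨Np + 1 + ∑ j ∈ S ×ˢ S, Nf j, by omega, ?_⟩
    intro s hs s' hs' x hx M
    have hmem : (s, s') ∈ S ×ˢ S := Finset.mk_mem_product hs hs'
    refine le_trans ?_ (hNf (s, s') hmem x hx M)
    apply Finset.sum_le_sum_of_subset_of_nonneg
    · apply Finset.Ico_subset_Ico_left
      have := Finset.single_le_sum (f := Nf) (fun j _ => Nat.zero_le _) hmem
      omega
    · intro k _ _; exact hg.nonneg _
  obtain ⟨N, hNp, hN⟩ := hN'
  obtain ⟨η, hη, hηg⟩ := hg.small ((1/2)^i / N) (by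
    have : (0:ℝ) < N := by exact_mod_cast (by omega : 0 < N)
    positivity)
  obtain ⟨J, hJ⟩ := exists_nat_one_div_lt (by linarith : (0:ℝ) < η / 2)
  obtain ⟨r2, hr2⟩ := common_ext (ι := List ℕ × ℕ)
    (fun j r => ∀ x ∈ (⋂ n, O n) ∩ Cyl (j.1 ++ r), ∀ y ∈ (⋂ n, O n) ∩ Cyl (j.1 ++ r),
      |Θ x j.2 - Θ y j.2| < η) (S ×ˢ Finset.range N)
    (by
      rintro ⟨s, k⟩ _ r
      obtain ⟨x, hxG, hxC⟩ := gen (s ++ r)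
      obtain ⟨q, hq⟩ := exists_rat_near (Θ x k) (by positivity : (0:ℝ) < 1/((J:ℝ)+1))
      have hxD : x ∈ D (Sum.inr (k, q, J)) := hq
      have hxW := (hGW x hxG (Sum.inr (k, q, J))).1 hxD
      obtain ⟨r', _, hr'⟩ := exists_Cyl_subset (hW (Sum.inr (k, q, J))) hxW hxC
      refine ⟨r', ?_⟩
      rw [← List.append_assoc]
      rintro y ⟨hyG, hyC⟩ z ⟨hzG, hzC⟩
      have h1 : |Θ y k - (q:ℝ)| < 1/((J:ℝ)+1) := (hGW y hyG (Sum.inr (k, q, J))).2 (hr' hyC)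
      have h2 : |Θ z k - (q:ℝ)| < 1/((J:ℝ)+1) := (hGW z hzG (Sum.inr (k, q, J))).2 (hr' hzC)
      have h3 := abs_sub_le (Θ y k) q (Θ z k)
      rw [abs_sub_comm (q:ℝ)] at h3
      show |Θ y k - Θ z k| < η
      linarith)
    (by
      rintro ⟨s, k⟩ _ r r' h x hx y hy
      have hsub : Cyl (s ++ (r ++ r')) ⊆ Cyl (s ++ r) := by
        rw [← List.append_assoc]; exact Cyl_append_subset _ _
      exact h x ⟨hx.1, hsub hx.2⟩ y ⟨hy.1, hsub hy.2⟩) r1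
  have hsub : ∀ s, Cyl (s ++ (r1 ++ r2)) ⊆ Cyl (s ++ r1) := by
    intro s; rw [← List.append_assoc]; exact Cyl_append_subset _ _
  refine ⟨r1 ++ r2, N, hNp, fun s hs => ⟨?_, ?_, ?_⟩⟩
  · exact (hsub s).trans (hr1 (s, s) (Finset.mk_mem_product hs hs)).1
  · intro s' hs' x hx
    exact hN s hs s' hs' x ⟨hx.1, hsub s hx.2⟩
  · intro x hx y hy
    have : ∀ k ∈ Finset.range N, g |Θ x k - Θ y k| ≤ (1/2)^i / N := fun k hk =>
      hηg _ (hr2 (s, k) (Finset.mk_mem_product hs hk) x hx y hy)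
    refine (Finset.sum_le_sum this).trans ?_
    rw [Finset.sum_const, Finset.card_range, nsmul_eq_mul]
    have : (0:ℝ) < N := by exact_mod_cast (by omega : 0 < N)
    rw [mul_div_cancel₀ _ this.ne']

/-- stems -/
def stem (r : ℕ → List ℕ) (v : ℕ → ℕ) : ℕ → List ℕ
  | 0 => []
  | i+1 => (stem r v i ++ [v i]) ++ r i

def stemLen (r : ℕ → List ℕ) : ℕ → ℕ
  | 0 => 0
  | i+1 => stemLen r i + 1 + (r i).length

def branch (r : ℕ → List ℕ) (v : ℕ → ℕ) : ℕ → ℕ := fun p => ((stem r v (p+1))[p]?).getD 0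

theorem stem_length (r : ℕ → List ℕ) (v : ℕ → ℕ) (i : ℕ) :
    (stem r v i).length = stemLen r i := by
  induction i with
  | zero => rfl
  | succ i ih => simp [stem, stemLen, ih]; omega

theorem stemLen_strictMono (r : ℕ → List ℕ) : StrictMono (stemLen r) :=
  strictMono_nat_of_lt_succ fun i => by simp [stemLen]; omega

theorem stem_congr (r : ℕ → List ℕ) {v v' : ℕ → ℕ} (i : ℕ) (h : ∀ j < i, v j = v' j) :
    stem r v i = stem r v' i := by
  induction i with
  | zero => rfl
  | succ i ih =>
    simp only [stem]
    rw [ih (fun j hj => h j (by omega)), h i (by omega)]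

theorem stem_prefix (r : ℕ → List ℕ) (v : ℕ → ℕ) {i j : ℕ} (h : i ≤ j) {p a : ℕ}
    (hp : (stem r v i)[p]? = some a) : (stem r v j)[p]? = some a := by
  induction j, h using Nat.le_induction with
  | base => exact hp
  | succ j hj ih =>
    have hlt : p < (stem r v j).length := by
      by_contra hc
      rw [List.getElem?_eq_none (by omega)] at ih
      exact absurd ih (by simp)
    simp only [stem, List.append_assoc]
    rw [List.getElem?_append_left hlt]; exact ih

theorem branch_mem (r : ℕ → List ℕ) (v : ℕ → ℕ) (i : ℕ) : branch r v ∈ Cyl (stem r v i) := by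
  intro p a h
  unfold branch
  rcases le_total i (p+1) with hi | hi
  · rw [stem_prefix r v hi h]; rfl
  · have hlt : p < (stem r v (p+1)).length := by
      rw [stem_length]
      have := (stemLen_strictMono r).le_apply (x := p+1)
      omega
    have h1 : (stem r v (p+1))[p]? = some ((stem r v (p+1))[p]) := by simp [hlt]
    have h2 := stem_prefix r v hi h1
    rw [h] at h2
    rw [h1]
    simp at h2
    simp [h2]

theorem branch_pos (r : ℕ → List ℕ) (v : ℕ → ℕ) (i : ℕ) : branch r v (stemLen r i) = v i := by
  apply branch_mem r v (i+1)
  simp only [stem, List.append_assoc]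
  rw [List.getElem?_append_right (by rw [stem_length]), stem_length]
  simp

theorem exists_block {N : ℕ → ℕ} (hN : StrictMono N) (h0 : N 0 = 0) (p : ℕ) :
    ∃ i, N i ≤ p ∧ p < N (i+1) := by
  induction p with
  | zero => exact ⟨0, by omega, by have := hN (Nat.lt_succ_self 0); simp at *; omega⟩
  | succ p ih =>
    obtain ⟨i, h1, h2⟩ := ih
    rcases lt_or_ge (p+1) (N (i+1)) with h | h
    · exact ⟨i, by omega, h⟩
    · refine ⟨i+1, h, ?_⟩
      have := hN (Nat.lt_succ_self (i+1))
      simp at *; omega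

theorem branch_congr (r : ℕ → List ℕ) {v v' : ℕ → ℕ} {p : ℕ}
    (h : ∀ j, p = stemLen r j → v j = v' j) : branch r v p = branch r v' p := by
  obtain ⟨i, h1, h2⟩ := exists_block (stemLen_strictMono r) rfl p
  rcases h1.eq_or_lt with heq | hlt
  · rw [← heq, branch_pos, branch_pos]; exact h i heq.symm
  · have hr : p - stemLen r i - 1 < (r i).length := by simp [stemLen] at h2; omega
    have : ∀ v, branch r v p = (r i)[p - stemLen r i - 1] := by
      intro v
      apply branch_mem r v (i+1)
      simp only [stem]
      rw [List.getElem?_append_right (by simp [stem_length]; omega)]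
      simp only [List.length_append, stem_length, List.length_singleton]
      rw [← Nat.sub_sub]
      simp [hr]
    rw [this, this]

open Classical in
theorem decomp {K : ℝ} {g : ℝ → ℝ} (hg : Gauge K g) (Θ : (ℕ → ℕ) → ℕ → ℝ)
    (hΘ : ∀ k, Measurable fun x => Θ x k)
    (Hfin : ∀ x s, Summable fun k => g |Θ x k - Θ (ov s x) k|)
    (F : ℕ → Finset ℕ) (hF : ∀ i, (F i).Nonempty) :
    ∃ (B : (ℕ → ℕ) → ℕ → ℕ) (pos N : ℕ → ℕ) (T : ℕ → ℕ → ℕ → ℝ),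
      StrictMono pos ∧ StrictMono N ∧ N 0 = 0 ∧ (∀ v i, B v (pos i) = v i) ∧
      (∀ v v' p, p ∉ range pos → B v p = B v' p) ∧
      ∀ v, (∀ i, v i ∈ F i) → ∀ i,
        ∑ k ∈ Finset.Ico (N i) (N (i+1)), g |Θ (B v) k - T i (v i) k| ≤ K * (3 * (1/2)^i) := by
  obtain ⟨O, hstep⟩ := step_exists hg Θ hΘ Hfin
  choose rr NN hNN hprop using hstep
  let nx : Finset (List ℕ) → ℕ → Finset (List ℕ) := fun S i =>
    Finset.image₂ (fun s a => s ++ [a]) S (F i)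
  let st : ℕ → Finset (List ℕ) × ℕ := fun i => Nat.rec ({[]}, 0)
    (fun i q => ((nx q.1 i).image (fun s => s ++ rr (nx q.1 i) i q.2), NN (nx q.1 i) i q.2)) i
  let S' : ℕ → Finset (List ℕ) := fun i => nx (st i).1 i
  let N : ℕ → ℕ := fun i => (st i).2
  let r : ℕ → List ℕ := fun i => rr (S' i) i (N i)
  have hN1 : ∀ i, N (i+1) = NN (S' i) i (N i) := fun i => rfl
  have hst1 : ∀ i, (st (i+1)).1 = (S' i).image (fun s => s ++ r i) := fun i => rfl
  have hNmono : StrictMono N := strictMono_nat_of_lt_succ fun i => by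
    rw [hN1]; exact hNN _ _ _
  have hmem : ∀ v : ℕ → ℕ, (∀ i, v i ∈ F i) → ∀ i, stem r v i ∈ (st i).1 := by
    intro v hv i
    induction i with
    | zero => show [] ∈ ({[]} : Finset (List ℕ)); simp
    | succ i ih =>
      rw [hst1]
      apply Finset.mem_image_of_mem (fun s => s ++ r i)
      exact Finset.mem_image₂_of_mem ih (hv i)
  have hmem' : ∀ v : ℕ → ℕ, (∀ i, v i ∈ F i) → ∀ i, stem r v i ++ [v i] ∈ S' i :=
    fun v hv i => Finset.mem_image₂_of_mem (hmem v hv i) (hv i)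
  have hG : ∀ v : ℕ → ℕ, (∀ i, v i ∈ F i) → branch r v ∈ ⋂ n, O n := by
    intro v hv
    rw [mem_iInter]
    intro i
    exact (hprop (S' i) i (N i) _ (hmem' v hv i)).1 (branch_mem r v (i+1))
  choose v0 hv0 using hF
  refine ⟨branch r, stemLen r, N, fun i a k => Θ (branch r (Function.update v0 i a)) k,
    stemLen_strictMono r, hNmono, rfl, branch_pos r, ?_, ?_⟩
  · intro v v' p hp
    apply branch_congr
    intro j hj
    exact absurd ⟨j, hj.symm⟩ hp
  · intro v hv i
    set vy : ℕ → ℕ := fun j => if j ≤ i then v j else v0 j with hvy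
    set vz : ℕ → ℕ := Function.update v0 i (v i) with hvz
    have hvyF : ∀ j, vy j ∈ F j := by
      intro j; simp only [hvy]; split_ifs
      · exact hv j
      · exact hv0 j
    have hvzF : ∀ j, vz j ∈ F j := by
      intro j
      by_cases hj : j = i
      · subst hj; simp [hvz, hv]
      · simp [hvz, hj, hv0]
    have hxy : ∑ k ∈ Finset.Ico (N i) (N (i+1)), g |Θ (branch r v) k - Θ (branch r vy) k|
        ≤ (1/2)^i := by
      have h1 := (hprop (S' i) i (N i) _ (hmem' v hv i)).2.2 (branch r v)
        ⟨hG v hv, branch_mem r v (i+1)⟩ (branch r vy) ⟨hG vy hvyF, by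
          have := branch_mem r vy (i+1)
          rw [stem_congr r (v' := v) (i+1) (fun j hj => by
            simp [hvy, Nat.lt_succ_iff.1 hj])] at this
          exact this⟩
      refine le_trans ?_ h1
      apply Finset.sum_le_sum_of_subset_of_nonneg
      · intro k hk
        rw [Finset.mem_Ico] at hk
        rw [Finset.mem_range, ← hN1]; exact hk.2
      · intro k _ _; exact hg.nonneg _
    have hyz : ∑ k ∈ Finset.Ico (N i) (N (i+1)), g |Θ (branch r vy) k - Θ (branch r vz) k|
        ≤ 2 * (1/2)^i := by
      rcases i with _ | j
      · have : vy = vz ∨ True := Or.inr trivial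
        have heq : branch r vy = branch r vz := by
          congr 1
          funext m
          by_cases hm : m = 0
          · subst hm; simp [hvy, hvz]
          · simp [hvy, hvz, hm]
        rw [heq]
        simp [hg.zero]
      · have hz : branch r vz = ov (stem r v0 j ++ [v0 j]) (branch r vy) := by
          funext p
          unfold ov
          rcases hq : (stem r v0 j ++ [v0 j])[p]? with _ | a
          · rw [Option.getD_none]
            apply branch_congr
            intro m hm
            rw [List.getElem?_eq_none_iff] at hq
            simp only [List.length_append, stem_length, List.length_singleton] at hq
            have hmj : j < m := by
              rw [← (stemLen_strictMono r).lt_iff_lt]; omega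
            by_cases hm' : m = j + 1
            · subst hm'; simp [hvy, hvz]
            · have : ¬ m ≤ j + 1 := by omega
              simp [hvy, hvz, hm', this]
          · rw [Option.getD_some]
            have h1 := branch_mem r vz (j+1)
            rw [stem_congr r (v' := v0) (j+1) (fun l hl => by
              have : l ≠ j + 1 := by omega
              simp [hvz, this])] at h1
            exact Cyl_append_subset _ _ h1 p a hq
        have h1 := (hprop (S' j) j (N j) _ (hmem' v hv j)).2.1 _ (hmem' v0 hv0 j) (branch r vy)
          ⟨hG vy hvyF, by
            have := branch_mem r vy (j+1)
            rw [stem_congr r (v' := v) (j+1) (fun l hl => by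
              have : l ≤ j + 1 := by omega
              simp [hvy, this])] at this
            exact this⟩ (N (j+1+1))
        rw [← hz] at h1
        rw [hN1 j]
        refine h1.trans (le_of_eq ?_)
        rw [pow_succ]; ring
    calc ∑ k ∈ Finset.Ico (N i) (N (i+1)), g |Θ (branch r v) k - Θ (branch r vz) k|
        ≤ ∑ k ∈ Finset.Ico (N i) (N (i+1)), K * (g |Θ (branch r v) k - Θ (branch r vy) k| +
            g |Θ (branch r vy) k - Θ (branch r vz) k|) :=
          Finset.sum_le_sum fun k _ => hg.tri _ _ _
      _ = K * (∑ k ∈ Finset.Ico (N i) (N (i+1)), g |Θ (branch r v) k - Θ (branch r vy) k| +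
            ∑ k ∈ Finset.Ico (N i) (N (i+1)), g |Θ (branch r vy) k - Θ (branch r vz) k|) := by
          rw [← Finset.mul_sum, Finset.sum_add_distrib]
      _ ≤ K * (3 * (1/2)^i) := by
          apply mul_le_mul_of_nonneg_left _ hg.Kpos.le
          linarith

/-! ### Non-reducibility -/

theorem Nice.le_geom {K : ℝ} {c : ℕ → ℝ} (h : Nice K c) (i k : ℕ) :
    c (i + k) ≤ (1/2)^k * c i := by
  induction k with
  | zero => simp
  | succ k ih =>
    have := h.half (i + k)
    rw [pow_succ, ← add_assoc]; linarith

theorem Nice.exists_small {K : ℝ} {c : ℕ → ℝ} (h : Nice K c) {ε : ℝ} (hε : 0 < ε) :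
    ∃ n, c n ≤ ε := by
  obtain ⟨n, hn⟩ := exists_pow_lt_of_lt_one (div_pos hε (h.pos 0)) (by norm_num : (1/2:ℝ) < 1)
  refine ⟨n, ?_⟩
  have h1 := h.le_geom 0 n
  rw [zero_add] at h1
  have h2 := (lt_div_iff₀ (h.pos 0)).1 hn
  linarith

theorem Nice.gauge {K : ℝ} {c : ℕ → ℝ} (h : Nice K c) : Gauge K (St c) where
  Kpos := h.K_pos
  meas := h.St_mono.measurable
  nonneg := h.St_nonneg
  zero := St_zero c
  tri := h.St_tri
  small := by
    intro ε hε
    obtain ⟨n, hn⟩ := h.exists_small hε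
    exact ⟨(1/2)^n, by positivity, fun t ht => (h.St_le ht.le).trans hn⟩

theorem Nice.St_pow {K : ℝ} {c : ℕ → ℝ} (h : Nice K c) (n : ℕ) : St c ((1/2)^n) = c n :=
  le_antisymm (h.St_le le_rfl) (h.St_ge (by
    rw [pow_succ]
    have : (0:ℝ) < (1/2)^n := by positivity
    linarith))

theorem summable_block {h : ℕ → ℝ} (h0 : ∀ k, 0 ≤ h k) {N : ℕ → ℕ} (hN : StrictMono N)
    (hN0 : N 0 = 0) :
    Summable h ↔ Summable fun i => ∑ k ∈ Finset.Ico (N i) (N (i+1)), h k := by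
  have hsum : ∀ m, ∑ i ∈ Finset.range m, ∑ k ∈ Finset.Ico (N i) (N (i+1)), h k
      = ∑ k ∈ Finset.range (N m), h k := by
    intro m
    induction m with
    | zero => simp [hN0]
    | succ m ih =>
      rw [Finset.sum_range_succ, ih, Finset.sum_range_add_sum_Ico _ (hN.monotone (Nat.le_succ m))]
  have hb0 : ∀ i, 0 ≤ ∑ k ∈ Finset.Ico (N i) (N (i+1)), h k :=
    fun i => Finset.sum_nonneg fun k _ => h0 k
  constructor
  · intro hs
    refine summable_of_sum_range_le (c := ∑' k, h k) hb0 fun m => ?_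
    rw [hsum]; exact hs.sum_le_tsum _ fun k _ => h0 k
  · intro hs
    refine summable_of_sum_range_le
      (c := ∑' i, ∑ k ∈ Finset.Ico (N i) (N (i+1)), h k) h0 fun m => ?_
    refine le_trans ?_ (hs.sum_le_tsum (Finset.range m) fun k _ => hb0 k)
    rw [hsum]
    exact Finset.sum_le_sum_of_subset_of_nonneg
      (Finset.range_subset_range.2 (hN.le_apply)) fun k _ _ => h0 k

theorem cat {K : ℝ} {c d : ℕ → ℝ} (hd : Nice K d)
    (hred : BorelReducible (EF (St c)) (EF (St d))) (e : ℕ → Icc (0:ℝ) 1)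
    (F : ℕ → Finset ℕ) (hF : ∀ i, (F i).Nonempty) :
    ∃ (N : ℕ → ℕ) (T : ℕ → ℕ → ℕ → ℝ), ∀ v v' : ℕ → ℕ, (∀ i, v i ∈ F i) → (∀ i, v' i ∈ F i) →
      ((Summable fun i => St c |(e (v i) : ℝ) - e (v' i)|) ↔
        Summable fun i => ∑ k ∈ Finset.Ico (N i) (N (i+1)), St d |T i (v i) k - T i (v' i) k|) := by
  obtain ⟨θ, hθ, hθr⟩ := hred
  have hg := hd.gauge
  set Θ : (ℕ → ℕ) → ℕ → ℝ := fun x k => (θ (fun p => e (x p)) k : ℝ) with hΘd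
  have hem : Measurable e := measurable_from_nat
  have hΘ : ∀ k, Measurable fun x => Θ x k := by
    intro k
    have h1 : Measurable fun x : ℕ → ℕ => (fun p => e (x p)) :=
      measurable_pi_lambda _ fun p => hem.comp (measurable_pi_apply p)
    exact measurable_subtype_coe.comp ((measurable_pi_apply k).comp (hθ.comp h1))
  have hEF : ∀ x y : ℕ → ℕ, (Summable fun p => St c |(e (x p) : ℝ) - e (y p)|) ↔
      Summable fun k => St d |Θ x k - Θ y k| := fun x y => hθr (fun p => e (x p)) (fun p => e (y p))
  have Hfin : ∀ x s, Summable fun k => St d |Θ x k - Θ (ov s x) k| := by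
    intro x s
    rw [← hEF]
    apply summable_of_ne_finset_zero (s := Finset.range s.length)
    intro p hp
    have : ov s x p = x p := by
      unfold ov
      rw [List.getElem?_eq_none (by simpa using hp)]; rfl
    rw [this]; simp [St_zero]
  obtain ⟨B, pos, N, T, hpos, hN, hN0, hB1, hB2, hB3⟩ := decomp hg Θ hΘ Hfin F hF
  refine ⟨N, T, fun v v' hv hv' => ?_⟩
  have h1 : (Summable fun i => St c |(e (v i) : ℝ) - e (v' i)|) ↔
      Summable fun p => St c |(e (B v p) : ℝ) - e (B v' p)| := by
    rw [← hpos.injective.summable_iff (f := fun p => St c |(e (B v p) : ℝ) - e (B v' p)|)]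
    · simp only [Function.comp_def, hB1]
    · intro p hp
      show St c |(e (B v p) : ℝ) - e (B v' p)| = 0
      rw [hB2 v v' p hp]; simp [St_zero]
  rw [h1, hEF, summable_block (fun k => hd.St_nonneg _) hN hN0]
  have hgeo : Summable fun i : ℕ => K * (3 * (1/2:ℝ)^i) :=
    ((summable_geometric_of_lt_one (by norm_num) (by norm_num)).mul_left 3).mul_left K
  have hK := hg.Kpos
  have tri4 : ∀ a b a' b' : ℝ, St d |a' - b'| ≤
      K * St d |a - a'| + K * (K * (St d |a - b| + St d |b - b'|)) := by
    intro a b a' b'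
    have e1 := hg.tri a' a b'
    have e2 := mul_le_mul_of_nonneg_left (hg.tri a b b') hK.le
    rw [abs_sub_comm a' a] at e1
    linarith
  have sum4 : ∀ (s : Finset ℕ) (a b a' b' : ℕ → ℝ), ∑ k ∈ s, St d |a' k - b' k| ≤
      K * ∑ k ∈ s, St d |a k - a' k| +
        K * (K * (∑ k ∈ s, St d |a k - b k| + ∑ k ∈ s, St d |b k - b' k|)) := by
    intro s a b a' b'
    rw [← Finset.sum_add_distrib, Finset.mul_sum, Finset.mul_sum, Finset.mul_sum,
      ← Finset.sum_add_distrib]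
    exact Finset.sum_le_sum fun k _ => tri4 _ _ _ _
  constructor
  · intro hs
    refine Summable.of_nonneg_of_le (fun i => Finset.sum_nonneg fun k _ => hd.St_nonneg _)
      (fun i => ?_) (((hgeo.mul_left K)).add (((hs.add hgeo).mul_left K).mul_left K))
    refine (sum4 _ (Θ (B v)) (Θ (B v')) _ _).trans ?_
    have e1 := hB3 v hv i
    have e2 := hB3 v' hv' i
    gcongr
  · intro hs
    refine Summable.of_nonneg_of_le (fun i => Finset.sum_nonneg fun k _ => hd.St_nonneg _)
      (fun i => ?_) (((hgeo.mul_left K)).add (((hs.add hgeo).mul_left K).mul_left K))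
    refine (sum4 _ (T i (v i)) (T i (v' i)) _ _).trans ?_
    have e1 := hB3 v hv i
    have e2 := hB3 v' hv' i
    simp only [abs_sub_comm (Θ _ _)] at e1 e2
    gcongr

theorem Nice.St_ratio {K : ℝ} {d : ℕ → ℝ} (hd : Nice K d) {x y : ℝ} (hx : 0 < x) (hxy : x ≤ y)
    (hy : y ≤ 1) : St d x * y ≤ 2 * x * St d y := by
  have hy0 : 0 < y := hx.trans_le hxy
  rw [St_pos_eq d hx, St_pos_eq d hy0]
  obtain ⟨k, hk⟩ := Nat.exists_eq_add_of_le (idx_anti hx hxy)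
  have h1 := hd.le_geom (idx y) k
  rw [← hk] at h1
  have h2 := (idx_spec hy0 hy).2
  have h3 := (idx_spec hx (hxy.trans hy)).1
  have hp := hd.pos (idx y)
  calc d (idx x) * y ≤ ((1/2)^k * d (idx y)) * (1/2)^(idx y) := by
        apply mul_le_mul h1 h2 hy0.le (by positivity)
    _ = (2 * (1/2)^(idx x + 1)) * d (idx y) := by rw [hk]; ring
    _ ≤ 2 * x * d (idx y) := by gcongr

theorem Nice.convex {K : ℝ} {d : ℕ → ℝ} (hd : Nice K d) (N : ℕ) (x : ℕ → ℝ)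
    (hx0 : ∀ a < N, 0 ≤ x a) (hx1 : ∀ a < N, 2 * N * x a ≤ 1) :
    N * St d (∑ a ∈ Finset.range N, x a) ≤ 2 * ∑ a ∈ Finset.range N, St d (2 * N * x a) := by
  set D := ∑ a ∈ Finset.range N, x a with hD
  have hD0 : 0 ≤ D := Finset.sum_nonneg fun a ha => hx0 a (Finset.mem_range.1 ha)
  rcases hD0.eq_or_lt with h | h
  · rw [← h, St_zero, mul_zero]
    exact mul_nonneg (by norm_num) (Finset.sum_nonneg fun a _ => hd.St_nonneg _)
  · have key : ∀ a ∈ Finset.range N, St d D * (2 * N * x a - D) ≤ 2 * D * St d (2 * N * x a) := by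
      intro a ha
      rw [Finset.mem_range] at ha
      have g0 := hd.St_nonneg D
      have g1 := hd.St_nonneg (2 * N * x a)
      rcases le_or_gt D (2 * N * x a) with hle | hgt
      · have := hd.St_ratio h hle (hx1 a ha)
        nlinarith
      · have : St d D * (2 * N * x a - D) ≤ 0 := mul_nonpos_of_nonneg_of_nonpos g0 (by linarith)
        have : 0 ≤ 2 * D * St d (2 * N * x a) := by positivity
        linarith
    have h2 := Finset.sum_le_sum key
    rw [← Finset.mul_sum, ← Finset.mul_sum, Finset.sum_sub_distrib, ← Finset.mul_sum, ← hD,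
      Finset.sum_const, Finset.card_range, nsmul_eq_mul] at h2
    have h3 : D * (N * St d D) ≤ D * (2 * ∑ a ∈ Finset.range N, St d (2 * N * x a)) := by linarith
    exact le_of_mul_le_mul_left h3 h

theorem summable_pair {h : ℕ → ℝ} (h0 : ∀ k, 0 ≤ h k) (Q : ℕ → Finset ℕ)
    (hQ : ∀ t q, q ∉ Q t → h (Nat.pair t q) = 0) :
    Summable h ↔ Summable fun t => ∑ q ∈ Q t, h (Nat.pair t q) := by
  rw [← Nat.pairEquiv.summable_iff, summable_prod_of_nonneg (f := h ∘ Nat.pairEquiv) (fun p => h0 _)]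
  have e1 : ∀ t, ∑' q, (h ∘ Nat.pairEquiv) (t, q) = ∑ q ∈ Q t, h (Nat.pair t q) := by
    intro t
    exact tsum_eq_sum fun q hq => hQ t q hq
  simp only [e1]
  constructor
  · exact fun h => h.2
  · intro h
    exact ⟨fun t => summable_of_ne_finset_zero (s := Q t) fun q hq => hQ t q hq, h⟩
noncomputable def dy (p : ℕ) : Icc (0:ℝ) 1 :=
  ⟨min 1 ((Nat.unpair p).1 * (1/2)^(Nat.unpair p).2), le_min zero_le_one (by positivity),
    min_le_left _ _⟩

theorem dy_pair {a n S : ℕ} (ha : a ≤ 2^S) (hS : S ≤ n) :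
    (dy (Nat.pair a n) : ℝ) = a * (1/2)^n := by
  simp only [dy, Nat.unpair_pair]
  apply min_eq_right
  have h1 : (a:ℝ) ≤ 2^n := by
    exact_mod_cast ha.trans (Nat.pow_le_pow_right (by norm_num) hS)
  calc (a:ℝ) * (1/2)^n ≤ 2^n * (1/2)^n := by gcongr
    _ = 1 := by rw [← mul_pow]; norm_num

theorem tau_bound {K : ℝ} {d : ℕ → ℝ} (hd : Nice K d) (S : ℕ) (s : Finset ℕ) (T : ℕ → ℕ → ℝ)
    {b cn ρ : ℝ} (hρ : 0 ≤ ρ)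
    (H : ∀ p, d p ≤ b → S + 1 ≤ p ∧ d (p - S - 1) * cn ≤ ρ * d p) (hcn : 0 < cn)
    (hb : ∀ a < 2^S, ∑ k ∈ s, St d |T a k - T (a+1) k| ≤ b) :
    cn * ∑ k ∈ s, St d |T 0 k - T (2^S) k| ≤ 2 * ρ * b := by
  have hb1 : ∀ a < 2^S, ∀ k ∈ s, St d |T a k - T (a+1) k| ≤ b := fun a ha k hk =>
    (Finset.single_le_sum (f := fun k => St d |T a k - T (a+1) k|)
      (fun k _ => hd.St_nonneg _) hk).trans (hb a ha)
  have hfact : ∀ a < 2^S, ∀ k ∈ s, 2 * ((2^S : ℕ) : ℝ) * |T a k - T (a+1) k| ≤ 1 ∧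
      cn * St d (2 * ((2^S : ℕ) : ℝ) * |T a k - T (a+1) k|) ≤ ρ * St d |T a k - T (a+1) k| := by
    intro a ha k hk
    have h1 := hb1 a ha k hk
    have hx0 : 0 ≤ |T a k - T (a+1) k| := abs_nonneg _
    generalize |T a k - T (a+1) k| = x at h1 hx0 ⊢
    rcases hx0.eq_or_lt with h0 | h0
    · rw [← h0]; simp [St_zero]
    · have h1' := h1
      rw [St_pos_eq d h0] at h1
      obtain ⟨hp, hq⟩ := H _ h1
      have hx1 : x ≤ 1 := by
        by_contra hc
        have : idx x ≤ 0 := idx_le (by norm_num; linarith)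
        omega
      have hx2 := (idx_spec h0 hx1).2
      obtain ⟨m, hm⟩ := Nat.exists_eq_add_of_le hp
      have e1 : idx x - S - 1 = m := by omega
      have h2 : 2 * ((2^S : ℕ) : ℝ) * x ≤ (1/2)^m := by
        calc 2 * ((2^S : ℕ) : ℝ) * x ≤ 2 * ((2^S : ℕ) : ℝ) * (1/2)^(idx x) := by gcongr
          _ = (2 * (1/2))^(S+1) * (1/2)^m := by
            rw [hm]; push_cast; rw [mul_pow]; ring
          _ = _ := by norm_num
      refine ⟨h2.trans (pow_le_one₀ (by norm_num) (by norm_num)), ?_⟩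
      rw [St_pos_eq d h0]
      rw [e1] at hq
      have := hd.St_le h2
      nlinarith
  have hk : ∀ k ∈ s, ((2^S : ℕ) : ℝ) * (cn * St d |T 0 k - T (2^S) k|) ≤
      2 * ∑ a ∈ Finset.range (2^S), ρ * St d |T a k - T (a+1) k| := by
    intro k hk
    have h1 : St d |T 0 k - T (2^S) k| ≤ St d (∑ a ∈ Finset.range (2^S), |T a k - T (a+1) k|) := by
      apply hd.St_mono
      rw [← Finset.sum_range_sub' (fun a => T a k)]
      exact Finset.abs_sum_le_sum_abs _ _
    have h2 := hd.convex (2^S) (fun a => |T a k - T (a+1) k|) (fun a _ => abs_nonneg _)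
      (fun a ha => (hfact a ha k hk).1)
    have h3 : cn * ∑ a ∈ Finset.range (2^S), St d (2 * ((2^S : ℕ) : ℝ) * |T a k - T (a+1) k|) ≤
        ∑ a ∈ Finset.range (2^S), ρ * St d |T a k - T (a+1) k| := by
      rw [Finset.mul_sum]
      exact Finset.sum_le_sum fun a ha => (hfact a (Finset.mem_range.1 ha) k hk).2
    have h4 : ((2^S : ℕ) : ℝ) * St d |T 0 k - T (2^S) k| ≤ ((2^S : ℕ) : ℝ) *
        St d (∑ a ∈ Finset.range (2^S), |T a k - T (a+1) k|) :=
      mul_le_mul_of_nonneg_left h1 (by positivity)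
    have h5 := mul_le_mul_of_nonneg_left (h4.trans h2) hcn.le
    linarith
  have h6 := Finset.sum_le_sum hk
  rw [← Finset.mul_sum, ← Finset.mul_sum, ← Finset.mul_sum, Finset.sum_comm] at h6
  have h7 : ∑ a ∈ Finset.range (2^S), ∑ k ∈ s, ρ * St d |T a k - T (a+1) k| ≤
      ((2^S : ℕ) : ℝ) * (ρ * b) := by
    have : ∀ a ∈ Finset.range (2^S), ∑ k ∈ s, ρ * St d |T a k - T (a+1) k| ≤ ρ * b := by
      intro a ha
      rw [← Finset.mul_sum]
      exact mul_le_mul_of_nonneg_left (hb a (Finset.mem_range.1 ha)) hρ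
    have := Finset.sum_le_sum this
    rwa [Finset.sum_const, Finset.card_range, nsmul_eq_mul] at this
  have hpos : (0:ℝ) < ((2^S : ℕ) : ℝ) := by positivity
  refine le_of_mul_le_mul_left (a := ((2^S : ℕ) : ℝ)) ?_ hpos
  linarith

theorem nonred {K : ℝ} {c d : ℕ → ℝ} (hc : Nice K c) (hd : Nice K d)
    (H : ∀ C ε : ℝ, 0 < C → 0 < ε → ∀ N0 : ℕ, ∃ n S : ℕ, S ≤ n ∧ N0 ≤ n - S ∧
      ∀ p, d p ≤ C * c n → S + 1 ≤ p ∧ d (p - S - 1) * c n ≤ ε * c (n - S) * d p) :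
    ¬ BorelReducible (EF (St c)) (EF (St d)) := by
  classical
  intro hred
  have hN0 : ∀ t : ℕ, ∃ N0, c N0 ≤ (1/2)^t := fun t => hc.exists_small (by positivity)
  choose N0 hN0 using hN0
  have H' := fun t : ℕ => H (4^t) ((1/8)^t) (by positivity) (by positivity) (N0 t)
  choose n S hSn hNn hH using H'
  set F : ℕ → Finset ℕ := fun i =>
    (Finset.range (2^(S (Nat.unpair i).1) + 1)).image fun a => Nat.pair a (n (Nat.unpair i).1)
    with hFd
  have hFmem : ∀ t q a, a ≤ 2^(S t) → Nat.pair a (n t) ∈ F (Nat.pair t q) := by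
    intro t q a ha
    simp only [hFd, Nat.unpair_pair]
    exact Finset.mem_image_of_mem (fun a => Nat.pair a (n t)) (Finset.mem_range.2 (by omega))
  have hF : ∀ i, (F i).Nonempty := fun i => by
    have := hFmem (Nat.unpair i).1 (Nat.unpair i).2 0 (Nat.zero_le _)
    rw [Nat.pair_unpair] at this
    exact ⟨_, this⟩
  obtain ⟨N, T, hT⟩ := cat hd (c := c) hred dy F hF
  set τ : ℕ → ℕ → ℕ → ℕ → ℝ := fun t q a b =>
    ∑ k ∈ Finset.Ico (N (Nat.pair t q)) (N (Nat.pair t q + 1)),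
      St d |T (Nat.pair t q) (Nat.pair a (n t)) k - T (Nat.pair t q) (Nat.pair b (n t)) k| with hτ
  have hτ0 : ∀ t q a b, 0 ≤ τ t q a b := fun t q a b =>
    Finset.sum_nonneg fun k _ => hd.St_nonneg _
  -- the main selection principle
  have sel : ∀ (Q : ℕ → Finset ℕ) (A B : ℕ → ℕ), (∀ t, A t ≤ 2^(S t)) → (∀ t, B t ≤ 2^(S t)) →
      ((Summable fun t => ((Q t).card : ℝ) * St c (|(A t : ℝ) - B t| * (1/2)^(n t))) ↔
        Summable fun t => ∑ q ∈ Q t, τ t q (A t) (B t)) := by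
    intro Q A B hA hB
    set v : ℕ → ℕ := fun i => Nat.pair (A (Nat.unpair i).1) (n (Nat.unpair i).1) with hv
    set v' : ℕ → ℕ := fun i => if (Nat.unpair i).2 ∈ Q (Nat.unpair i).1 then
      Nat.pair (B (Nat.unpair i).1) (n (Nat.unpair i).1) else v i with hv'
    have hvF : ∀ i, v i ∈ F i := by
      intro i
      have := hFmem (Nat.unpair i).1 (Nat.unpair i).2 _ (hA (Nat.unpair i).1)
      rwa [Nat.pair_unpair] at this
    have hvF' : ∀ i, v' i ∈ F i := by
      intro i
      have := hFmem (Nat.unpair i).1 (Nat.unpair i).2 _ (hB (Nat.unpair i).1)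
      rw [Nat.pair_unpair] at this
      simp only [hv']
      split_ifs
      · exact this
      · exact hvF i
    have hmain := hT v v' hvF hvF'
    rw [summable_pair (fun i => hc.St_nonneg _) Q, summable_pair
      (fun i => Finset.sum_nonneg fun k _ => hd.St_nonneg _) Q] at hmain
    · have e1 : ∀ t, ∑ q ∈ Q t, St c |(dy (v (Nat.pair t q)) : ℝ) - dy (v' (Nat.pair t q))| =
          ((Q t).card : ℝ) * St c (|(A t : ℝ) - B t| * (1/2)^(n t)) := by
        intro t
        rw [← nsmul_eq_mul, ← Finset.sum_const]
        apply Finset.sum_congr rfl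
        intro q hq
        simp only [hv', hv, Nat.unpair_pair, if_pos hq]
        rw [dy_pair (hA t) (hSn t), dy_pair (hB t) (hSn t), ← sub_mul, abs_mul,
          abs_of_pos (by positivity : (0:ℝ) < (1/2)^(n t))]
      have e2 : ∀ t, (∑ q ∈ Q t, ∑ k ∈ Finset.Ico (N (Nat.pair t q)) (N (Nat.pair t q + 1)),
          St d |T (Nat.pair t q) (v (Nat.pair t q)) k - T (Nat.pair t q) (v' (Nat.pair t q)) k|)
          = ∑ q ∈ Q t, τ t q (A t) (B t) := by
        intro t
        apply Finset.sum_congr rfl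
        intro q hq
        simp only [hv', hv, Nat.unpair_pair, if_pos hq, hτ]
      simp only [e1, e2] at hmain
      exact hmain
    · intro t q hq
      simp only [hv', hv, Nat.unpair_pair, if_neg hq]
      simp [St_zero]
    · intro t q hq
      simp only [hv', hv, Nat.unpair_pair, if_neg hq]
      simp [St_zero]
  have hgeo : Summable fun t : ℕ => (1/2:ℝ)^t :=
    summable_geometric_of_lt_one (by norm_num) (by norm_num)
  have hcS : ∀ t, c (n t - S t) ≤ (1/2)^t := fun t => (hc.anti (hNn t)).trans (hN0 t)
  have hcn : ∀ t, c (n t) ≤ (1/2)^t := fun t => (hc.anti (Nat.sub_le _ _)).trans (hcS t)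
  set Bad : ℕ → Prop := fun t => ∃ a < 2^(S t), {q : ℕ | 4^t * c (n t) < τ t q a (a+1)}.Infinite
    with hBad
  by_cases hinf : {t | Bad t}.Infinite
  · -- infinitely many bad types
    set M : ℕ → ℕ := fun t => ⌈(1/2)^t / c (n t)⌉₊ with hM
    have hsel : ∀ t, ∃ (a : ℕ) (Q : Finset ℕ), a < 2^(S t) ∧ Q.card ≤ M t ∧
        (Bad t → Q.card = M t ∧ ∀ q ∈ Q, 4^t * c (n t) < τ t q a (a+1)) := by
      intro t
      by_cases hb : Bad t
      · obtain ⟨a, ha, hi⟩ := hb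
        obtain ⟨Q, hQ1, hQ2⟩ := hi.exists_subset_card_eq (M t)
        exact ⟨a, Q, ha, hQ2.le, fun _ => ⟨hQ2, fun q hq => hQ1 hq⟩⟩
      · exact ⟨0, ∅, by positivity, by simp, fun h => absurd h hb⟩
    choose A Q hA hQ hQb using hsel
    have hs := sel Q A (fun t => A t + 1) (fun t => (hA t).le) (fun t => hA t)
    have h1 : Summable fun t => ((Q t).card : ℝ) *
        St c (|(A t : ℝ) - ((A t + 1 : ℕ) : ℝ)| * (1/2)^(n t)) := by
      refine Summable.of_nonneg_of_le
        (fun t => mul_nonneg (Nat.cast_nonneg _) (hc.St_nonneg _)) (fun t => ?_) (hgeo.mul_left 2)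
      have e : |(A t : ℝ) - ((A t + 1 : ℕ) : ℝ)| * (1/2)^(n t) = (1/2)^(n t) := by
        push_cast; rw [sub_add_cancel_left]; simp
      rw [e, hc.St_pow]
      have hp := hc.pos (n t)
      have h2 : ((Q t).card : ℝ) ≤ (1/2)^t / c (n t) + 1 :=
        (Nat.cast_le.2 (hQ t)).trans (Nat.ceil_lt_add_one (by positivity)).le
      have h3 := mul_le_mul_of_nonneg_right h2 hp.le
      rw [add_mul, div_mul_cancel₀ _ hp.ne'] at h3
      have := hcn t
      linarith
    have h2 := hs.1 h1
    have h3 := h2.tendsto_atTop_zero.eventually (gt_mem_nhds (zero_lt_one))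
    have h4 := Nat.frequently_atTop_iff_infinite.2 hinf
    obtain ⟨t, hbt, ht⟩ := (h4.and_eventually h3).exists
    obtain ⟨hq1, hq2⟩ := hQb t hbt
    have h5 := Finset.sum_le_sum fun q hq => (hq2 q hq).le
    rw [Finset.sum_const, nsmul_eq_mul, hq1] at h5
    have hp := hc.pos (n t)
    have h6 : (1/2)^t / c (n t) ≤ (M t : ℝ) := Nat.le_ceil _
    rw [div_le_iff₀ hp] at h6
    have h7 : (1:ℝ) ≤ 4^t * (1/2)^t := by
      rw [← mul_pow]; exact one_le_pow₀ (by norm_num)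
    have h8 : (4:ℝ)^t * (1/2)^t ≤ 4^t * (M t * c (n t)) := by gcongr
    linarith
  · rw [Set.not_infinite] at hinf
    obtain ⟨t0, ht0⟩ := hinf.bddAbove
    set M : ℕ → ℕ := fun t => ⌈1 / c (n t - S t)⌉₊ with hM
    have hsel : ∀ t, ∃ Q : Finset ℕ, Q.card ≤ M t ∧ (t0 < t → Q.card = M t) ∧
        ∀ q ∈ Q, ∀ a < 2^(S t), τ t q a (a+1) ≤ 4^t * c (n t) := by
      intro t
      by_cases ht : t0 < t
      · have hnb : ¬ Bad t := fun hb => by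
          have := ht0 hb; omega
        simp only [hBad] at hnb
        push Not at hnb
        have hfin : (⋃ a ∈ Finset.range (2^(S t)),
            {q : ℕ | 4^t * c (n t) < τ t q a (a+1)}).Finite := by
          apply Set.Finite.biUnion (Finset.finite_toSet _)
          intro a ha
          exact hnb a (by simpa using ha)
        obtain ⟨Q, hQ1, hQ2⟩ := hfin.infinite_compl.exists_subset_card_eq (M t)
        refine ⟨Q, hQ2.le, fun _ => hQ2, fun q hq a ha => ?_⟩
        have := hQ1 hq
        by_contra hcon
        apply this
        simp only [mem_iUnion]
        exact ⟨a, Finset.mem_range.2 ha, not_le.1 hcon⟩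
      · exact ⟨∅, by simp, fun h => absurd h ht, by simp⟩
    choose Q hQ1 hQ2 hQ3 using hsel
    have hs := sel Q (fun _ => 0) (fun t => 2^(S t)) (fun t => Nat.zero_le _) (fun t => le_rfl)
    have hst : ∀ t, St c (|((0:ℕ) : ℝ) - ((2^(S t) : ℕ) : ℝ)| * (1/2)^(n t)) = c (n t - S t) := by
      intro t
      rw [← hc.St_pow]
      congr 1
      obtain ⟨m, hm⟩ := Nat.exists_eq_add_of_le (hSn t)
      have : n t - S t = m := by omega
      rw [this, hm]
      push_cast
      rw [zero_sub, abs_neg, abs_of_pos (by positivity), pow_add, ← mul_assoc, ← mul_pow]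
      norm_num
    have h1 : Summable fun t => ∑ q ∈ Q t, τ t q 0 (2^(S t)) := by
      refine Summable.of_nonneg_of_le (fun t => Finset.sum_nonneg fun q _ => hτ0 _ _ _ _)
        (fun t => ?_) (hgeo.mul_left 4)
      have hp := hc.pos (n t)
      have hp' := hc.pos (n t - S t)
      have hb : ∀ q ∈ Q t, τ t q 0 (2^(S t)) ≤ 2 * (1/2)^t * c (n t - S t) := by
        intro q hq
        have := tau_bound hd (S t) (Finset.Ico (N (Nat.pair t q)) (N (Nat.pair t q + 1)))
          (fun a k => T (Nat.pair t q) (Nat.pair a (n t)) k) (b := 4^t * c (n t)) (cn := c (n t))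
          (ρ := (1/8)^t * c (n t - S t)) (by positivity) (hH t) hp
          (fun a ha => hQ3 t q hq a ha)
        refine le_of_mul_le_mul_left (a := c (n t)) (this.trans (le_of_eq ?_)) hp
        have e : ((1:ℝ)/8)^t * 4^t = (1/2)^t := by rw [← mul_pow]; norm_num
        rw [← e]; ring
      refine (Finset.sum_le_sum hb).trans ?_
      rw [Finset.sum_const, nsmul_eq_mul]
      have h2 : ((Q t).card : ℝ) ≤ 1 / c (n t - S t) + 1 :=
        (Nat.cast_le.2 (hQ1 t)).trans (Nat.ceil_lt_add_one (by positivity)).le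
      have h3 := mul_le_mul_of_nonneg_right h2 hp'.le
      rw [add_mul, div_mul_cancel₀ _ hp'.ne'] at h3
      have h4 : c (n t - S t) ≤ 1 := (hcS t).trans (pow_le_one₀ (by norm_num) (by norm_num))
      have h5 : ((Q t).card : ℝ) * c (n t - S t) ≤ 2 := by linarith
      have h6 : (0:ℝ) < (1/2)^t := by positivity
      nlinarith
    have h2 := hs.2 h1
    simp only [hst] at h2
    have h3 := h2.tendsto_atTop_zero.eventually (gt_mem_nhds (zero_lt_one))
    obtain ⟨t, ht, ht'⟩ := (h3.and (Filter.eventually_gt_atTop t0)).exists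
    rw [hQ2 t ht'] at ht
    have hp' := hc.pos (n t - S t)
    have h6 : 1 / c (n t - S t) ≤ (M t : ℝ) := Nat.le_ceil _
    rw [div_le_iff₀ hp'] at h6
    linarith
/-! ### Sequence criteria -/

structure SV (K : ℝ) (w : ℕ → ℝ) : Prop where
  pos : ∀ n, 0 < w n
  anti : Antitone w
  dbl : ∀ n, w n ≤ K * w (2*n+1)

theorem SV.one_le {K : ℝ} {w : ℕ → ℝ} (h : SV K w) : 1 ≤ K := by
  have h1 := h.dbl 0
  have h2 := h.anti (by norm_num : 0 ≤ 2*0+1)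
  have h3 := h.pos (2*0+1)
  have h4 : 1 * w (2*0+1) ≤ K * w (2*0+1) := by linarith
  exact le_of_mul_le_mul_right h4 h3

theorem SV.le_of {K : ℝ} {w : ℕ → ℝ} (h : SV K w) {m n : ℕ} (hmn : n ≤ 2*m+1) :
    w m ≤ K * w n :=
  (h.dbl m).trans (mul_le_mul_of_nonneg_left (h.anti hmn) (by linarith [h.one_le]))

theorem SV.mono {K K' : ℝ} {w : ℕ → ℝ} (h : SV K w) (hK : K ≤ K') : SV K' w :=
  ⟨h.pos, h.anti, fun n => (h.dbl n).trans (mul_le_mul_of_nonneg_right hK (h.pos _).le)⟩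

theorem SV.nice {K β : ℝ} {w : ℕ → ℝ} (h : SV K w) (hβ : 0 < β) (hβ2 : β ≤ 1/2) :
    Nice (K/β) (fun n => β^n * w n) where
  pos n := mul_pos (pow_pos hβ n) (h.pos n)
  half n := by
    have h1 := h.anti (Nat.le_succ n)
    have h2 := h.pos (n+1)
    have h3 := pow_pos hβ n
    calc 2 * (β^(n+1) * w (n+1)) = (2*β) * (β^n * w (n+1)) := by ring
      _ ≤ 1 * (β^n * w n) := by
        apply mul_le_mul (by linarith) _ (by positivity) (by norm_num)
        exact mul_le_mul_of_nonneg_left h1 h3.le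
      _ = _ := one_mul _
  dbl n := by
    have h1 := h.le_of (m := n) (n := n+1) (by omega)
    have h3 := pow_pos hβ n
    calc β^n * w n ≤ β^n * (K * w (n+1)) := mul_le_mul_of_nonneg_left h1 h3.le
      _ = K/β * (β^(n+1) * w (n+1)) := by field_simp; ring

theorem SV.poly {K : ℝ} {w : ℕ → ℝ} (h : SV K w) :
    ∃ q : ℕ, ∀ n : ℕ, w 0 ≤ ((n:ℝ)+1)^q * w n := by
  obtain ⟨q, hq⟩ := pow_unbounded_of_one_lt K (by norm_num : (1:ℝ) < 4/3)
  refine ⟨q, fun n => ?_⟩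
  induction n using Nat.strong_induction_on with
  | _ n ih =>
    rcases Nat.eq_zero_or_pos n with rfl | hn
    · simp
    · have h1 := ih (n/2) (by omega)
      have h2 := h.le_of (m := n/2) (n := n) (by omega)
      have h3 : 4 * (((n/2 : ℕ):ℝ) + 1) ≤ 3 * ((n:ℝ) + 1) := by
        exact_mod_cast (by omega : 4 * (n/2 + 1) ≤ 3 * (n + 1))
      have hw := h.pos n
      calc w 0 ≤ (((n/2 : ℕ):ℝ) + 1)^q * w (n/2) := h1
        _ ≤ (((n/2 : ℕ):ℝ) + 1)^q * ((4/3)^q * w n) := by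
          apply mul_le_mul_of_nonneg_left _ (by positivity)
          exact h2.trans (mul_le_mul_of_nonneg_right hq.le hw.le)
        _ = (4/3 * (((n/2 : ℕ):ℝ) + 1))^q * w n := by rw [mul_pow]; ring
        _ ≤ ((n:ℝ)+1)^q * w n := by
          apply mul_le_mul_of_nonneg_right _ hw.le
          exact pow_le_pow_left₀ (by positivity) (by linarith) q

theorem SV.exp {K β : ℝ} {w : ℕ → ℝ} (h : SV K w) (hβ : 0 < β) (hβ2 : β ≤ 1/2) :
    ∃ C : ℝ, 0 < C ∧ ∀ n : ℕ, β^(n/2) ≤ C * w n := by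
  obtain ⟨q, hq⟩ := h.poly
  have ht := tendsto_pow_const_mul_const_pow_of_abs_lt_one q
    (by rw [abs_of_pos] <;> norm_num : |(1/2:ℝ)| < 1)
  obtain ⟨b, hb⟩ := ht.bddAbove_range
  have hb' : ∀ m : ℕ, ((m:ℝ)+1)^q * (1/2)^(m+1) ≤ b := by
    intro m
    have := hb ⟨m+1, rfl⟩
    simpa using this
  have hb0 : 0 < b := lt_of_lt_of_le (by positivity) (hb' 0)
  refine ⟨2 * 2^q * b / w 0, by have := h.pos 0; positivity, fun n => ?_⟩
  have h0 := h.pos 0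
  have hn := h.pos n
  rw [div_mul_eq_mul_div, le_div_iff₀ h0]
  have h1 : (n:ℝ) + 1 ≤ 2 * (((n/2:ℕ):ℝ)+1) := by
    exact_mod_cast (by omega : n + 1 ≤ 2 * (n/2+1))
  calc β^(n/2) * w 0 ≤ (1/2)^(n/2) * (((n:ℝ)+1)^q * w n) := by
        apply mul_le_mul _ (hq n) h0.le (by positivity)
        exact pow_le_pow_left₀ hβ.le hβ2 _
    _ ≤ (1/2)^(n/2) * ((2 * (((n/2:ℕ):ℝ)+1))^q * w n) := by gcongr
    _ = 2 * 2^q * ((((n/2:ℕ):ℝ)+1)^q * (1/2)^(n/2+1)) * w n := by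
      rw [mul_pow, pow_succ]; ring
    _ ≤ 2 * 2^q * b * w n := by
      have := hb' (n/2)
      gcongr

open Classical in
theorem critA {K β K0 : ℝ} {w v : ℕ → ℝ} (hw : SV K w) (hv : SV K v) (hβ : 0 < β) (hβ2 : β ≤ 1/2)
    (hR : ∀ m n, m ≤ n → w m * v n ≤ K0 * (w n * v m)) :
    BorelReducible (EF (St fun n => β^n * w n)) (EF (St fun n => β^n * v n)) := by
  obtain ⟨C, hC, hexp⟩ := hv.exp hβ hβ2
  have hK := hw.one_le
  have hw0 := hw.pos 0
  have hv0 := hv.pos 0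
  set P : ℕ → ℕ → Prop := fun n k => ∃ m ≤ n, w 0 * v m ≤ β^k * (w m * v 0) with hP
  set e : ℕ → ℕ := fun n => Nat.findGreatest (P n) (n/2) with he
  have hP0 : ∀ n, P n 0 := fun n => ⟨0, Nat.zero_le _, by simp⟩
  have heP : ∀ n, P n (e n) := fun n => Nat.findGreatest_spec (Nat.zero_le _) (hP0 n)
  have he2 : ∀ n, e n ≤ n/2 := fun n => Nat.findGreatest_le _
  have hmono : Monotone e := by
    intro m n hmn
    apply Nat.findGreatest_mono
    · rintro k ⟨i, hi, hk⟩
      exact ⟨i, hi.trans hmn, hk⟩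
    · omega
  -- bounds on `R`
  have hlow : ∀ n, w 0 * v n ≤ K0 * (β^(e n) * (w n * v 0)) := by
    intro n
    obtain ⟨m, hm, h1⟩ := heP n
    have h2 := hR m n hm
    have hvm := hv.pos m
    refine le_of_mul_le_mul_right (a := v m) ?_ hvm
    calc w 0 * v n * v m = (w 0 * v m) * v n := by ring
      _ ≤ (β^(e n) * (w m * v 0)) * v n := mul_le_mul_of_nonneg_right h1 (hv.pos n).le
      _ = (β^(e n) * v 0) * (w m * v n) := by ring
      _ ≤ (β^(e n) * v 0) * (K0 * (w n * v m)) := mul_le_mul_of_nonneg_left h2 (by positivity)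
      _ = _ := by ring
  have hup : ∀ n, β^(e n) * w n ≤ (w 0 * C + w 0 / v 0 / β) * v n := by
    intro n
    have hvn := hv.pos n
    have hwn := hw.pos n
    rw [add_mul]
    rcases (he2 n).eq_or_lt with h | h
    · have h1 : β^(e n) * w n ≤ (C * v n) * w 0 := by
        rw [h]
        exact mul_le_mul (hexp n) (hw.anti (Nat.zero_le n)) hwn.le (by positivity)
      have h2 : 0 ≤ w 0 / v 0 / β * v n := by positivity
      linarith
    · have h1 : ¬ P n (e n + 1) := Nat.findGreatest_is_greatest (Nat.lt_succ_self _) h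
      simp only [hP] at h1
      push Not at h1
      have h2 := h1 n le_rfl
      have h3 : β^(e n) * w n ≤ w 0 / v 0 / β * v n := by
        rw [div_div, div_mul_eq_mul_div, le_div_iff₀ (by positivity)]
        calc β^(e n) * w n * (v 0 * β) = β^(e n + 1) * (w n * v 0) := by ring
          _ ≤ _ := h2.le
      have h4 : 0 ≤ w 0 * C * v n := by positivity
      linarith
  have hK0 : 0 < K0 := by
    have h1 := hR 0 0 le_rfl
    have h2 : 0 < w 0 * v 0 := by positivity
    by_contra h
    have : K0 * (w 0 * v 0) ≤ 0 := mul_nonpos_of_nonpos_of_nonneg (not_lt.1 h) h2.le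
    linarith
  have hcomm : ∀ n, β^n = β^(n - e n) * β^(e n) := by
    intro n
    rw [← pow_add]; congr 1
    have := he2 n; omega
  set D := w 0 * C + w 0 / v 0 / β with hD
  have hDpos : 0 < D := by positivity
  apply reduction (hw.nice hβ hβ2) (hv.nice hβ hβ2) e hmono
    (fun n => (he2 n).trans (Nat.div_le_self _ _)) (C := D + K * K0 * v 0 / w 0) (by positivity)
  · intro n
    have h1 := hup n
    have h2 := hv.anti (Nat.sub_le n (e n))
    have hvn := hv.pos (n - e n)
    show β^n * w n ≤ _ * (β^(n - e n) * v (n - e n))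
    calc β^n * w n = β^(n - e n) * (β^(e n) * w n) := by rw [hcomm n]; ring
      _ ≤ β^(n - e n) * (D * v (n - e n)) := by
        apply mul_le_mul_of_nonneg_left _ (by positivity)
        exact h1.trans (mul_le_mul_of_nonneg_left h2 hDpos.le)
      _ = D * (β^(n - e n) * v (n - e n)) := by ring
      _ ≤ _ := by
        apply mul_le_mul_of_nonneg_right _ (by positivity)
        have : 0 ≤ K * K0 * v 0 / w 0 := by positivity
        linarith
  · intro n
    have h1 := hlow n
    have h2 := hv.le_of (m := n - e n) (n := n) (by have := he2 n; omega)
    have hwn := hw.pos n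
    show β^(n - e n) * v (n - e n) ≤ _ * (β^n * w n)
    calc β^(n - e n) * v (n - e n) ≤ β^(n - e n) * (K * v n) := by gcongr
      _ = β^(n - e n) * K / w 0 * (w 0 * v n) := by field_simp
      _ ≤ β^(n - e n) * K / w 0 * (K0 * (β^(e n) * (w n * v 0))) := by gcongr
      _ = K * K0 * v 0 / w 0 * ((β^(n - e n) * β^(e n)) * w n) := by ring
      _ = K * K0 * v 0 / w 0 * (β^n * w n) := by rw [← hcomm n]
      _ ≤ _ := by
        apply mul_le_mul_of_nonneg_right _ (by positivity)
        linarith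

theorem critB {K β : ℝ} {w v : ℕ → ℝ} (hw : SV K w) (hv : SV K v) (hβ : 0 < β) (hβ2 : β ≤ 1/2)
    (hR : ∀ ε : ℝ, 0 < ε → ∀ A : ℕ, ∃ r n : ℕ, r ≤ n ∧ (A*(n+1))^A ≤ 2^r ∧
      w n * v r ≤ ε * (w r * v n)) :
    ¬ BorelReducible (EF (St fun n => β^n * w n)) (EF (St fun n => β^n * v n)) := by
  have hK := hw.one_le
  apply nonred (hw.nice hβ hβ2) (hv.nice hβ hβ2)
  intro C ε hC hε N0
  obtain ⟨q, hq⟩ := hv.poly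
  have hw0 := hw.pos 0
  have hv0 := hv.pos 0
  set C' := C * w 0 / v 0 with hC'
  have hC'0 : 0 < C' := by positivity
  obtain ⟨A0, hA0⟩ := exists_nat_ge (16 * C'^2)
  set A := A0 + (2*q+4) + N0 with hA
  obtain ⟨r, n, hrn, hpoly, hRn⟩ := hR (ε * β / K^2) (by positivity) A
  refine ⟨n, n - r, Nat.sub_le _ _, ?_, ?_⟩
  · have h1 : 2^A ≤ 2^r := by
      refine le_trans (Nat.pow_le_pow_left ?_ A) hpoly
      have : 2 ≤ A := by omega
      nlinarith
    have := (Nat.pow_le_pow_iff_right (by norm_num : 1 < 2)).1 h1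
    omega
  intro p hp
  have hvp := hv.pos p
  have hvn := hv.pos n
  have hwn := hw.pos n
  have hwr := hw.pos r
  have hvr := hv.pos r
  have hpr : n + 2 ≤ p + r/2 := by
    rcases le_or_gt n p with hnp | hnp
    · have h1 : 2^4 ≤ 2^r := by
        refine le_trans ?_ hpoly
        have : 2 ≤ A := by omega
        calc 2^4 ≤ 2^A * 2^A := by
              rw [← pow_add]
              exact Nat.pow_le_pow_right (by norm_num) (by omega)
          _ = (2*2)^A := by rw [mul_pow]
          _ ≤ (A*(n+1))^A := by
            apply Nat.pow_le_pow_left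
            have : 4 ≤ A := by omega
            nlinarith
      have := (Nat.pow_le_pow_iff_right (by norm_num : 1 < 2)).1 h1
      omega
    · have h1 : β^p * (v 0) ≤ C * w 0 * ((n:ℝ)+1)^q * β^n := by
        have e1 := hq p
        have e2 : ((p:ℝ)+1)^q ≤ ((n:ℝ)+1)^q := by
          apply pow_le_pow_left₀ (by positivity)
          have : (p:ℝ) ≤ n := by exact_mod_cast hnp.le
          linarith
        calc β^p * v 0 ≤ β^p * (((n:ℝ)+1)^q * v p) := by
              apply mul_le_mul_of_nonneg_left _ (by positivity)
              exact e1.trans (mul_le_mul_of_nonneg_right e2 hvp.le)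
          _ = ((n:ℝ)+1)^q * (β^p * v p) := by ring
          _ ≤ ((n:ℝ)+1)^q * (C * (β^n * w n)) := by gcongr
          _ ≤ ((n:ℝ)+1)^q * (C * (β^n * w 0)) := by
            have := hw.anti (Nat.zero_le n)
            gcongr
          _ = _ := by ring
      obtain ⟨k, hk⟩ := Nat.exists_eq_add_of_lt hnp
      have h2 : (2:ℝ)^(k+1) ≤ C' * ((n:ℝ)+1)^q := by
        have e0 : β^n = β^p * β^(k+1) := by rw [← pow_add, hk]; congr 1
        rw [e0] at h1
        have e1 : v 0 ≤ C * w 0 * ((n:ℝ)+1)^q * β^(k+1) := by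
          refine le_of_mul_le_mul_left (a := β^p) ?_ (by positivity)
          linarith
        have e2 : β^(k+1) ≤ (1/2)^(k+1) := pow_le_pow_left₀ hβ.le hβ2 _
        have e3 : (2:ℝ)^(k+1) * (1/2)^(k+1) = 1 := by rw [← mul_pow]; norm_num
        rw [hC', div_mul_eq_mul_div, le_div_iff₀ hv0]
        calc (2:ℝ)^(k+1) * v 0 ≤ 2^(k+1) * (C * w 0 * ((n:ℝ)+1)^q * (1/2)^(k+1)) := by
              apply mul_le_mul_of_nonneg_left _ (by positivity)
              refine e1.trans ?_
              gcongr
          _ = (C * w 0 * ((n:ℝ)+1)^q) * (2^(k+1) * (1/2)^(k+1)) := by ring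
          _ = _ := by rw [e3, mul_one]
      have h3 : (2:ℝ)^(2*(k+1)+4) ≤ 2^r := by
        have e1 : ((A:ℝ)*((n:ℝ)+1))^A ≤ 2^r := by exact_mod_cast hpoly
        refine le_trans ?_ e1
        have hAr : (1:ℝ) ≤ A := by exact_mod_cast (by omega : 1 ≤ A)
        have hA0' : (A0:ℝ) ≤ A := by exact_mod_cast (by omega : A0 ≤ A)
        have hn1 : (1:ℝ) ≤ (n:ℝ)+1 := by linarith [(Nat.cast_nonneg n : (0:ℝ) ≤ n)]
        have e2 : (1:ℝ) ≤ (A:ℝ)*((n:ℝ)+1) := by nlinarith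
        calc (2:ℝ)^(2*(k+1)+4) = (2^(k+1))^2 * 16 := by rw [pow_add, mul_comm 2, pow_mul]; norm_num
          _ ≤ (C' * ((n:ℝ)+1)^q)^2 * 16 := by gcongr
          _ = (16 * C'^2) * ((n:ℝ)+1)^(2*q) := by rw [mul_pow, ← pow_mul, mul_comm q]; ring
          _ ≤ A * ((n:ℝ)+1)^(2*q) := by gcongr; linarith
          _ ≤ A * ((n:ℝ)+1) * (A * ((n:ℝ)+1))^(2*q) := by
            apply mul_le_mul
            · nlinarith
            · apply pow_le_pow_left₀ (by positivity)
              nlinarith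
            · positivity
            · positivity
          _ = (A * ((n:ℝ)+1))^(2*q+1) := by ring
          _ ≤ _ := pow_le_pow_right₀ e2 (by omega)
      have h4 := (pow_le_pow_iff_right₀ (by norm_num : (1:ℝ) < 2)).1 h3
      omega
  have hpS : n - r + 1 ≤ p := by omega
  refine ⟨hpS, ?_⟩
  show β^(p - (n-r) - 1) * v (p - (n-r) - 1) * (β^n * w n) ≤
    ε * (β^(n - (n-r)) * w (n - (n-r))) * (β^p * v p)
  have er : n - (n - r) = r := by omega
  rw [er]
  have key : v (p - (n-r) - 1) * w n ≤ ε * β * (w r * v p) := by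
    have hε' : w n * v r * K^2 ≤ ε * β * (w r * v n) := by
      have : ε * β / K^2 * (w r * v n) = (ε * β * (w r * v n)) / K^2 := by ring
      rw [this, le_div_iff₀ (by positivity)] at hRn
      exact hRn
    rcases le_or_gt p (2*n+1) with hc | hc
    · have h1 := hv.le_of hc
      have h2 := hv.le_of (m := p - (n-r) - 1) (n := r) (by omega)
      refine le_of_mul_le_mul_right (a := K) ?_ (by positivity)
      calc v (p - (n-r) - 1) * w n * K ≤ (K * v r) * w n * K := by gcongr
        _ = w n * v r * K^2 := by ring
        _ ≤ ε * β * (w r * v n) := hε'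
        _ ≤ ε * β * (w r * (K * v p)) := by gcongr
        _ = _ := by ring
    · have h2 := hv.le_of (m := p - (n-r) - 1) (n := p) (by omega)
      have h3 := hv.anti hrn
      have h4 : w n * K^2 ≤ ε * β * w r := by
        refine le_of_mul_le_mul_right (a := v r) ?_ hvr
        calc w n * K^2 * v r = w n * v r * K^2 := by ring
          _ ≤ ε * β * (w r * v n) := hε'
          _ ≤ ε * β * (w r * v r) := by gcongr
          _ = _ := by ring
      have h5 : w n * K ≤ w n * K^2 := by
        apply mul_le_mul_of_nonneg_left _ hwn.le
        nlinarith
      calc v (p - (n-r) - 1) * w n ≤ K * v p * w n := by gcongr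
        _ = w n * K * v p := by ring
        _ ≤ ε * β * w r * v p := mul_le_mul_of_nonneg_right (h5.trans h4) hvp.le
        _ = _ := by ring
  have epow : β^(p - (n-r) - 1) * β^n * β = β^r * β^p := by
    rw [← pow_add, ← pow_succ, ← pow_add]; congr 1; omega
  refine le_of_mul_le_mul_right (a := β) ?_ hβ
  calc β^(p - (n-r) - 1) * v (p - (n-r) - 1) * (β^n * w n) * β
      = (β^(p - (n-r) - 1) * β^n * β) * (v (p - (n-r) - 1) * w n) := by ring
    _ = (β^r * β^p) * (v (p - (n-r) - 1) * w n) := by rw [epow]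
    _ ≤ (β^r * β^p) * (ε * β * (w r * v p)) := by gcongr
    _ = _ := by ring
/-! ### The iterated logarithms -/

theorem tFun_ge (j : ℕ) {x : ℝ} (hx : 0 < x) (hx1 : x ≤ 1) : 1 ≤ tFun j x := by
  induction j with
  | zero =>
    have := Real.logb_nonpos (by norm_num : (1:ℝ) < 2) hx.le hx1
    simp only [tFun]; linarith
  | succ j ih =>
    have := Real.logb_nonneg (by norm_num : (1:ℝ) < 2) ih
    simp only [tFun]; linarith

theorem tFun_anti (j : ℕ) {x y : ℝ} (hx : 0 < x) (hxy : x ≤ y) (hy : y ≤ 1) :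
    tFun j y ≤ tFun j x := by
  induction j with
  | zero =>
    have := Real.logb_le_logb_of_le (by norm_num : (1:ℝ) < 2) hx hxy
    simp only [tFun]; linarith
  | succ j ih =>
    have h1 := tFun_ge j (hx.trans_le hxy) hy
    have := Real.logb_le_logb_of_le (by norm_num : (1:ℝ) < 2) (by linarith) ih
    simp only [tFun]; linarith

noncomputable def TT (j n : ℕ) : ℝ := tFun j ((1/2)^n)

theorem half_pow_pos (n : ℕ) : (0:ℝ) < (1/2)^n := by positivity

theorem half_pow_le_one (n : ℕ) : ((1:ℝ)/2)^n ≤ 1 := pow_le_one₀ (by norm_num) (by norm_num)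

theorem TT_ge (j n : ℕ) : 1 ≤ TT j n := tFun_ge j (half_pow_pos n) (half_pow_le_one n)

theorem TT_pos (j n : ℕ) : 0 < TT j n := lt_of_lt_of_le one_pos (TT_ge j n)

theorem TT_mono (j : ℕ) : Monotone (TT j) := fun _ _ h =>
  tFun_anti j (half_pow_pos _) (pow_le_pow_of_le_one (by norm_num) (by norm_num) h)
    (half_pow_le_one _)

theorem TT_zero (n : ℕ) : TT 0 n = 1 + n := by
  simp only [TT, tFun]
  rw [half_pow_eq, Real.logb_rpow (by norm_num) (by norm_num)]; ring

theorem TT_succ (j n : ℕ) : TT (j+1) n = 1 + Real.logb 2 (TT j n) := rfl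

theorem logb_mono {x y : ℝ} (hx : 0 < x) (h : x ≤ y) : Real.logb 2 x ≤ Real.logb 2 y :=
  Real.logb_le_logb_of_le (by norm_num) hx h

theorem logb_two_mul {x : ℝ} (hx : 0 < x) : Real.logb 2 (2*x) = 1 + Real.logb 2 x := by
  rw [Real.logb_mul (by norm_num) hx.ne', Real.logb_self_eq_one (by norm_num)]

theorem TT_dbl (j n : ℕ) : TT j (2*n+1) ≤ 2 * TT j n := by
  induction j with
  | zero => rw [TT_zero, TT_zero]; push_cast; linarith
  | succ j ih =>
    have h1 := logb_mono (TT_pos j _) ih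
    rw [logb_two_mul (TT_pos j n)] at h1
    have h2 := TT_ge (j+1) n
    rw [TT_succ] at h2 ⊢
    rw [TT_succ]
    linarith

theorem TT_pow (j k : ℕ) : TT j k ≤ TT (j+1) (2^k) ∧ TT (j+1) (2^k) ≤ 1 + TT j k := by
  induction j with
  | zero =>
    rw [TT_succ, TT_zero, TT_zero]
    push_cast
    have h0 : (1:ℝ) ≤ 2^k := one_le_pow₀ (by norm_num)
    have e1 : Real.logb 2 ((2:ℝ)^k) = k := by
      rw [← Real.rpow_natCast, Real.logb_rpow (by norm_num) (by norm_num)]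
    have h1 := logb_mono (x := (2:ℝ)^k) (y := 1 + 2^k) (by positivity) (by linarith)
    have h2 := logb_mono (x := 1 + (2:ℝ)^k) (y := 2 * 2^k) (by positivity) (by linarith)
    rw [logb_two_mul (by positivity), e1] at h2
    rw [e1] at h1
    constructor <;> linarith
  | succ j ih =>
    have h1 := logb_mono (TT_pos j _) ih.1
    have h2 := logb_mono (TT_pos (j+1) _) (ih.2.trans
      (by linarith [TT_ge j k] : _ ≤ 2 * TT j k))
    rw [logb_two_mul (TT_pos j k)] at h2
    rw [TT_succ (j+1), TT_succ j k]
    constructor <;> linarith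

theorem TT_kIter (j m : ℕ) : (2:ℝ)^(m+1) ≤ TT j (kIter j m) ∧
    TT j (kIter j m) ≤ (j+2) * 2^(m+1) := by
  have : 1 + (2:ℝ)^(m+1) ≤ TT j (kIter j m) ∧ TT j (kIter j m) ≤ 1 + j + 2^(m+1) := by
    induction j with
    | zero =>
      rw [TT_zero]; simp [kIter]
    | succ j ih =>
      have := TT_pow j (kIter j m)
      simp only [kIter]
      push_cast
      constructor <;> linarith
  have h0 : (1:ℝ) ≤ 2^(m+1) := one_le_pow₀ (by norm_num)
  have hj : (0:ℝ) ≤ j := Nat.cast_nonneg j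
  constructor
  · linarith
  · nlinarith

/-! ### towers -/

theorem kIter_two_mul (j m : ℕ) : 2 * kIter j m ≤ kIter j (m+1) := by
  induction j with
  | zero => simp only [kIter]; rw [pow_succ 2 (m+1)]; omega
  | succ j ih =>
    simp only [kIter]
    have h0 : 1 ≤ kIter j m := by
      cases j with
      | zero => simp only [kIter]; exact Nat.one_le_two_pow
      | succ j => simp only [kIter]; exact Nat.one_le_two_pow
    calc 2 * 2^(kIter j m) = 2^(kIter j m + 1) := by rw [pow_succ]; omega
      _ ≤ _ := Nat.pow_le_pow_right (by norm_num) (by omega)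

theorem kIter_pos (j m : ℕ) : 0 < kIter j m := by
  cases j <;> simp [kIter]

theorem kIter_strictMono (j : ℕ) : StrictMono (kIter j) :=
  strictMono_nat_of_lt_succ fun m => by
    have := kIter_two_mul j m
    have := kIter_pos j m
    omega

theorem lt_kIter (j m : ℕ) : m < kIter j m := by
  induction j with
  | zero => simp only [kIter]; exact (Nat.lt_succ_self m).trans (Nat.lt_two_pow_self)
  | succ j ih => simp only [kIter]; exact ih.trans Nat.lt_two_pow_self

theorem poly_exp (A B : ℕ) : ∃ K0, ∀ K ≥ K0, (A * (B * K + 1))^A ≤ 2^K := by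
  set C := A * (B+1) + 1 with hC
  have ht := tendsto_pow_const_div_const_pow_of_one_lt A (by norm_num : (1:ℝ) < 2)
  have hpos : (0:ℝ) < 1 / (C:ℝ)^A := by
    have : (0:ℝ) < C := by exact_mod_cast (by omega : 0 < C)
    positivity
  obtain ⟨K0, hK0⟩ := Filter.eventually_atTop.1 (ht.eventually (gt_mem_nhds hpos))
  refine ⟨K0 + 1, fun K hK => ?_⟩
  have h1 := hK0 K (by omega)
  have hCp : (0:ℝ) < (C:ℝ)^A := by
    have : (0:ℝ) < C := by exact_mod_cast (by omega : 0 < C)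
    positivity
  rw [div_lt_div_iff₀ (by positivity) hCp] at h1
  have h2 : K^A * C^A ≤ 2^K := by
    have : ((K^A * C^A : ℕ):ℝ) ≤ ((2^K : ℕ):ℝ) := by push_cast; linarith
    exact_mod_cast this
  refine le_trans ?_ h2
  rw [← mul_pow]
  apply Nat.pow_le_pow_left
  have : B * K + 1 ≤ (B+1) * K := by nlinarith
  calc A * (B * K + 1) ≤ A * ((B+1) * K) := Nat.mul_le_mul_left _ this
    _ ≤ K * C := by rw [hC]; nlinarith

theorem growth (j : ℕ) : ∀ A M : ℕ, ∃ m0, ∀ m ≥ m0, M ≤ m ∧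
    (A * (kIter j m + 1))^A ≤ 2^(kIter j (m - M)) := by
  induction j with
  | zero =>
    intro A M
    obtain ⟨K0, hK0⟩ := poly_exp A (2^M)
    refine ⟨K0 + M, fun m hm => ⟨by omega, ?_⟩⟩
    have h1 : kIter 0 m = 2^M * kIter 0 (m - M) := by
      simp only [kIter]; rw [← pow_add]; congr 1; omega
    rw [h1]
    apply hK0
    have := lt_kIter 0 (m - M)
    omega
  | succ j ih =>
    intro A M
    obtain ⟨m0, hm0⟩ := ih (A+2) M
    refine ⟨m0, fun m hm => ?_⟩
    obtain ⟨h1, h2⟩ := hm0 m hm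
    refine ⟨h1, ?_⟩
    simp only [kIter]
    generalize kIter j m = κ at h2 ⊢
    have h3 : A * (2^κ + 1) ≤ 2^(A + (κ+1)) := by
      rw [pow_add]
      apply Nat.mul_le_mul Nat.lt_two_pow_self.le
      rw [pow_succ]
      have : 1 ≤ 2^κ := Nat.one_le_two_pow
      omega
    calc (A * (2^κ + 1))^A ≤ (2^(A + (κ+1)))^A := Nat.pow_le_pow_left h3 A
      _ = 2^((A + (κ+1)) * A) := by rw [pow_mul]
      _ ≤ _ := by
        apply Nat.pow_le_pow_right (by norm_num)
        refine le_trans ?_ h2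
        calc (A + (κ+1)) * A ≤ ((A+2) * (κ+1))^2 := by nlinarith [Nat.zero_le κ, Nat.zero_le A, Nat.zero_le (A*κ), Nat.zero_le (A*A*κ)]
          _ ≤ _ := Nat.pow_le_pow_right (by nlinarith) (by omega)

/-! ### `l_η` along dyadics -/

noncomputable def LL (η : List ℝ) (n : ℕ) : ℝ := lFun η ((1/2)^n)

theorem getD_bd {η : List ℝ} (hη : ∀ x ∈ η, 0 ≤ x ∧ x < 1) (i : ℕ) :
    0 ≤ η.getD i 0 ∧ η.getD i 0 < 1 := by
  rcases lt_or_ge i η.length with h | h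
  · rw [List.getD_eq_getElem _ _ h]; exact hη _ (List.getElem_mem h)
  · rw [List.getD_eq_default _ _ h]; norm_num

theorem lFun_pos (η : List ℝ) {x : ℝ} (hx : 0 < x) (hx1 : x ≤ 1) : 0 < lFun η x :=
  Finset.prod_pos fun i _ => Real.rpow_pos_of_pos (by linarith [tFun_ge i hx hx1]) _

theorem lFun_anti {η : List ℝ} (hη : ∀ x ∈ η, 0 ≤ x ∧ x < 1) {x y : ℝ} (hx : 0 < x) (hxy : x ≤ y)
    (hy : y ≤ 1) : lFun η y ≤ lFun η x := by
  apply Finset.prod_le_prod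
  · intro i _
    exact (Real.rpow_pos_of_pos (by linarith [tFun_ge i (hx.trans_le hxy) hy]) _).le
  · intro i _
    exact Real.rpow_le_rpow (by linarith [tFun_ge i (hx.trans_le hxy) hy]) (tFun_anti i hx hxy hy)
      (getD_bd hη i).1

theorem LL_pos (η : List ℝ) (n : ℕ) : 0 < LL η n := lFun_pos η (half_pow_pos n) (half_pow_le_one n)

theorem LL_mono {η : List ℝ} (hη : ∀ x ∈ η, 0 ≤ x ∧ x < 1) : Monotone (LL η) := fun _ _ h =>
  lFun_anti hη (half_pow_pos _) (pow_le_pow_of_le_one (by norm_num) (by norm_num) h)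
    (half_pow_le_one _)

theorem LL_eq (η : List ℝ) {N : ℕ} (hN : η.length ≤ N) (n : ℕ) :
    LL η n = ∏ i ∈ Finset.range N, TT i n ^ η.getD i 0 := by
  unfold LL lFun
  apply Finset.prod_subset (Finset.range_subset_range.2 hN)
  intro i _ hi
  rw [Finset.mem_range, not_lt] at hi
  rw [List.getD_eq_default _ _ hi, Real.rpow_zero]

theorem LL_dbl {η : List ℝ} (hη : ∀ x ∈ η, 0 ≤ x ∧ x < 1) (n : ℕ) :
    LL η (2*n+1) ≤ 2^η.length * LL η n := by
  rw [LL_eq η le_rfl, LL_eq η le_rfl]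
  have : (2:ℝ)^η.length = ∏ i ∈ Finset.range η.length, (2:ℝ) := by simp
  rw [this, ← Finset.prod_mul_distrib]
  apply Finset.prod_le_prod
  · intro i _; exact (Real.rpow_pos_of_pos (TT_pos _ _) _).le
  · intro i _
    obtain ⟨h0, h1⟩ := getD_bd hη i
    calc TT i (2*n+1) ^ η.getD i 0 ≤ (2 * TT i n) ^ η.getD i 0 :=
          Real.rpow_le_rpow (TT_pos _ _).le (TT_dbl i n) h0
      _ = 2 ^ η.getD i 0 * TT i n ^ η.getD i 0 := Real.mul_rpow (by norm_num) (TT_pos _ _).le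
      _ ≤ 2 * TT i n ^ η.getD i 0 := by
        apply mul_le_mul_of_nonneg_right _ (Real.rpow_pos_of_pos (TT_pos _ _) _).le
        calc (2:ℝ) ^ η.getD i 0 ≤ 2 ^ (1:ℝ) :=
              Real.rpow_le_rpow_of_exponent_le (by norm_num) h1.le
          _ = 2 := Real.rpow_one 2

theorem SV_div {η : List ℝ} (hη : ∀ x ∈ η, 0 ≤ x ∧ x < 1) {K : ℝ} {u : ℕ → ℝ} (hu : SV K u) :
    SV (K * 2^η.length) (fun n => u n / LL η n) where
  pos n := div_pos (hu.pos n) (LL_pos η n)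
  anti := by
    intro m n h
    exact div_le_div₀ (hu.pos m).le (hu.anti h) (LL_pos η m) (LL_mono hη h)
  dbl n := by
    have h1 := hu.dbl n
    have h2 := LL_dbl hη n
    have p1 := LL_pos η n
    have p2 := LL_pos η (2*n+1)
    have p3 := hu.pos (2*n+1)
    have hK := hu.one_le
    show u n / LL η n ≤ K * 2^η.length * (u (2*n+1) / LL η (2*n+1))
    rw [← mul_div_assoc, div_le_div_iff₀ p1 p2]
    calc u n * LL η (2*n+1) ≤ (K * u (2*n+1)) * (2^η.length * LL η n) := by
          apply mul_le_mul h1 h2 p2.le (by positivity)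
      _ = _ := by ring

theorem EF_eq_St {f : ℝ → ℝ} {K : ℝ} {c : ℕ → ℝ} (hc : Nice K c) (h0 : f 0 = 0)
    (hm : ∀ x y, 0 < x → x ≤ y → y ≤ 1 → f x ≤ f y) (hv : ∀ n : ℕ, f ((1/2)^n) = c n) :
    EF f = EF (St c) := by
  have hb : ∀ x ∈ Icc (0:ℝ) 1, 0 ≤ f x ∧ f x ≤ St c x ∧ St c x ≤ K * f x := by
    rintro x ⟨hx0, hx1⟩
    rcases hx0.eq_or_lt with h | h
    · rw [← h, h0, St_zero]; simp
    · obtain ⟨h1, h2⟩ := idx_spec h hx1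
      have h3 := hm _ _ (half_pow_pos _) h1.le hx1
      have h4 := hm _ _ h h2 (half_pow_le_one _)
      rw [hv] at h3 h4
      rw [St_pos_eq c h]
      exact ⟨(hc.pos _).le.trans h3, h4,
        (hc.dbl _).trans (mul_le_mul_of_nonneg_left h3 hc.K_pos.le)⟩
  refine EF_congr (C := max 1 K) (fun x hx => (hb x hx).1) (fun x _ => hc.St_nonneg x) ?_ ?_
  · intro x hx
    have := (hb x hx).2.1
    have h2 : 1 * St c x ≤ max 1 K * St c x :=
      mul_le_mul_of_nonneg_right (le_max_left _ _) (hc.St_nonneg x)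
    linarith
  · intro x hx
    exact (hb x hx).2.2.trans (mul_le_mul_of_nonneg_right (le_max_right _ _) (hb x hx).1)

theorem EF_eq {α : ℝ} (hα : 1 ≤ α) {η : List ℝ} (hη : ∀ x ∈ η, 0 ≤ x ∧ x < 1) {K : ℝ}
    {u : ℕ → ℝ} (hu : SV K u) {φ : ℝ → ℝ} (hφ : MonotoneOn φ (Icc 0 1))
    (hφ0 : ∀ t ∈ Icc (0:ℝ) 1, 0 ≤ φ t) (hv : ∀ n : ℕ, φ ((1/2)^n) = u n) :
    EF (fun x => if x = 0 then 0 else x ^ α * φ x / lFun η x) =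
      EF (St fun n => ((2:ℝ)^(-α))^n * (u n / LL η n)) := by
  have hβ : (0:ℝ) < 2^(-α) := by positivity
  have hβ2 : (2:ℝ)^(-α) ≤ 1/2 := by
    calc (2:ℝ)^(-α) ≤ 2^(-1:ℝ) := Real.rpow_le_rpow_of_exponent_le (by norm_num) (by linarith)
      _ = 1/2 := by rw [Real.rpow_neg_one]; norm_num
  apply EF_eq_St ((SV_div hη hu).nice hβ hβ2)
  · simp
  · intro x y hx hxy hy
    have hy0 : 0 < y := hx.trans_le hxy
    simp only [hx.ne', hy0.ne', if_false]
    have m1 : x ∈ Icc (0:ℝ) 1 := ⟨hx.le, hxy.trans hy⟩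
    have m2 : y ∈ Icc (0:ℝ) 1 := ⟨hy0.le, hy⟩
    apply div_le_div₀
    · exact mul_nonneg (by positivity) (hφ0 y m2)
    · exact mul_le_mul (Real.rpow_le_rpow hx.le hxy (by linarith)) (hφ m1 m2 hxy) (hφ0 x m1)
        (by positivity)
    · exact lFun_pos η hy0 hy
    · exact lFun_anti hη hx hxy hy
  · intro n
    simp only [(half_pow_pos n).ne', if_false]
    rw [hv, mul_div_assoc]
    have : (((1:ℝ)/2)^n)^α = ((2:ℝ)^(-α))^n := by
      rw [half_pow_eq, ← Real.rpow_mul (by norm_num), ← Real.rpow_natCast,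
        ← Real.rpow_mul (by norm_num)]
      congr 1; ring
    rw [this]; rfl
/-! ### The sequences `u_U` -/

structure US (j : ℕ) (δ : ℝ) (I : Set ℕ) (u : ℕ → ℝ) : Prop where
  zero : u 0 = 1
  step : ∀ n m, n + 1 = kIter j m → m ∈ I → u (n+1) = δ * u n
  const : ∀ n, (¬ ∃ m, n + 1 = kIter j m ∧ m ∈ I) → u (n+1) = u n

open Classical in
noncomputable def Dset (j : ℕ) (I : Set ℕ) (r n : ℕ) : Finset ℕ :=
  (Finset.range n).filter fun m => r < kIter j m ∧ kIter j m ≤ n ∧ m ∈ I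

theorem mem_Dset {j : ℕ} {I : Set ℕ} {r n m : ℕ} :
    m ∈ Dset j I r n ↔ r < kIter j m ∧ kIter j m ≤ n ∧ m ∈ I := by
  simp only [Dset, Finset.mem_filter, Finset.mem_range, and_iff_right_iff_imp]
  rintro ⟨_, h, _⟩
  exact (lt_kIter j m).trans_le h

theorem US.ratio {j : ℕ} {δ : ℝ} {I : Set ℕ} {u : ℕ → ℝ} (h : US j δ I u) {r n : ℕ}
    (hrn : r ≤ n) : u n = δ^(Dset j I r n).card * u r := by
  classical
  induction n, hrn using Nat.le_induction with
  | base =>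
    have : Dset j I r r = ∅ := by
      ext m; rw [mem_Dset]; simp; omega
    simp [this]
  | succ n hn ih =>
    by_cases hc : ∃ m, n + 1 = kIter j m ∧ m ∈ I
    · obtain ⟨m, hm, hmI⟩ := hc
      have hD : Dset j I r (n+1) = insert m (Dset j I r n) := by
        ext i
        rw [Finset.mem_insert, mem_Dset, mem_Dset]
        constructor
        · rintro ⟨h1, h2, h3⟩
          rcases h2.eq_or_lt with h4 | h4
          · left; apply (kIter_strictMono j).injective; rw [h4, hm]
          · right; exact ⟨h1, by omega, h3⟩
        · rintro (rfl | ⟨h1, h2, h3⟩)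
          · exact ⟨by omega, by omega, hmI⟩
          · exact ⟨h1, by omega, h3⟩
      have hnot : m ∉ Dset j I r n := by
        rw [mem_Dset]; rintro ⟨_, h2, _⟩; omega
      rw [hD, Finset.card_insert_of_notMem hnot, h.step n m hm hmI, ih, pow_succ]; ring
    · have hD : Dset j I r (n+1) = Dset j I r n := by
        ext i
        rw [mem_Dset, mem_Dset]
        constructor
        · rintro ⟨h1, h2, h3⟩
          refine ⟨h1, ?_, h3⟩
          by_contra h4
          exact hc ⟨i, by omega, h3⟩
        · rintro ⟨h1, h2, h3⟩; exact ⟨h1, by omega, h3⟩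
      rw [hD, h.const n hc, ih]

theorem US.sv {j : ℕ} {δ : ℝ} {I : Set ℕ} {u : ℕ → ℝ} (h : US j δ I u) (h0 : 0 < δ) (h1 : δ < 1) :
    SV δ⁻¹ u := by
  have hpos : ∀ n, 0 < u n := by
    intro n
    rw [h.ratio (Nat.zero_le n), h.zero]; positivity
  refine ⟨hpos, ?_, ?_⟩
  · intro m n hmn
    rw [h.ratio hmn]
    exact mul_le_of_le_one_left (hpos m).le (pow_le_one₀ h0.le h1.le)
  · intro n
    rw [h.ratio (by omega : n ≤ 2*n+1), ← mul_assoc]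
    have hcard : (Dset j I n (2*n+1)).card ≤ 1 := by
      rw [Finset.card_le_one]
      have aux : ∀ a ∈ Dset j I n (2*n+1), ∀ b ∈ Dset j I n (2*n+1), ¬ a < b := by
        intro a ha b hb hab
        rw [mem_Dset] at ha hb
        have e1 := kIter_two_mul j a
        have e2 := (kIter_strictMono j).monotone (Nat.succ_le_of_lt hab)
        simp only [Nat.succ_eq_add_one] at e2
        omega
      intro a ha b hb
      have e1 := aux a ha b hb
      have e2 := aux b hb a ha
      omega
    have h2 : δ^1 ≤ δ^(Dset j I n (2*n+1)).card := pow_le_pow_of_le_one h0.le h1.le hcard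
    have h3 : 1 ≤ δ⁻¹ * δ^(Dset j I n (2*n+1)).card := by
      calc (1:ℝ) = δ⁻¹ * δ^1 := by rw [pow_one, inv_mul_cancel₀ h0.ne']
        _ ≤ _ := mul_le_mul_of_nonneg_left h2 (by positivity)
    exact le_mul_of_one_le_left (hpos n).le h3

theorem Dset_card (j : ℕ) (I : Set ℕ) {r n : ℕ} (hrn : r ≤ n) :
    (2:ℝ)^(Dset j I r n).card * TT j r ≤ 2 * (j+2) * TT j n := by
  have hj : (0:ℝ) ≤ j := Nat.cast_nonneg j
  have hr := TT_pos j r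
  have hn := TT_pos j n
  rcases (Dset j I r n).eq_empty_or_nonempty with h | h
  · rw [h]
    have := TT_mono j hrn
    simp only [Finset.card_empty, pow_zero, one_mul]
    nlinarith
  · set i1 := (Dset j I r n).min' h with hi1
    set i2 := (Dset j I r n).max' h with hi2
    have m1 := mem_Dset.1 ((Dset j I r n).min'_mem h)
    have m2 := mem_Dset.1 ((Dset j I r n).max'_mem h)
    rw [← hi1] at m1
    rw [← hi2] at m2
    have hle : i1 ≤ i2 := Finset.min'_le _ _ ((Dset j I r n).max'_mem h)
    have hcard : (Dset j I r n).card ≤ i2 + 1 - i1 := by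
      rw [← Nat.card_Icc]
      apply Finset.card_le_card
      intro i hi
      exact Finset.mem_Icc.2 ⟨Finset.min'_le _ _ hi, Finset.le_max' _ _ hi⟩
    have e1 : TT j r ≤ (j+2) * 2^(i1+1) := (TT_mono j m1.1.le).trans (TT_kIter j i1).2
    have e2 : (2:ℝ)^(i2+1) ≤ TT j n := (TT_kIter j i2).1.trans (TT_mono j m2.2.1)
    calc (2:ℝ)^(Dset j I r n).card * TT j r ≤ 2^(i2+1-i1) * ((j+2) * 2^(i1+1)) := by
          apply mul_le_mul _ e1 hr.le (by positivity)
          exact pow_le_pow_right₀ (by norm_num) hcard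
      _ = (j+2) * (2^(i2+1-i1) * 2^(i1+1)) := by ring
      _ = (j+2) * (2 * 2^(i2+1)) := by
        rw [← pow_add, ← pow_succ']; congr 2; omega
      _ ≤ (j+2) * (2 * TT j n) := by gcongr
      _ = _ := by ring

/-! ### Comparison of iterated logarithms -/

theorem log_bd {τ : ℝ} (hτ : 0 < τ) : ∃ C : ℝ, 0 < C ∧ ∀ x : ℝ, 1 ≤ x →
    1 + Real.logb 2 x ≤ C * x^τ := by
  have hl : 0 < Real.log 2 := Real.log_pos (by norm_num)
  refine ⟨1 + 1/(τ * Real.log 2), by positivity, fun x hx => ?_⟩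
  have h1 := Real.log_le_rpow_div (by linarith : 0 ≤ x) hτ
  have h2 := Real.one_le_rpow hx hτ.le
  have h3 : Real.logb 2 x ≤ 1/(τ * Real.log 2) * x^τ := by
    unfold Real.logb
    rw [div_le_iff₀ hl]
    refine h1.trans (le_of_eq ?_)
    field_simp
  rw [add_mul, one_mul]; linarith

theorem TT_ratio_succ (j : ℕ) {r n : ℕ} (hrn : r ≤ n) :
    TT (j+1) n ≤ (1 + Real.logb 2 (TT j n / TT j r)) * TT (j+1) r := by
  have hr := TT_pos j r
  have hn := TT_pos j n
  have hX : 1 ≤ TT j n / TT j r := (one_le_div hr).2 (TT_mono j hrn)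
  have h1 := Real.logb_nonneg (by norm_num : (1:ℝ) < 2) hX
  have h2 := Real.logb_nonneg (by norm_num : (1:ℝ) < 2) (TT_ge j r)
  have h3 : Real.logb 2 (TT j n) = Real.logb 2 (TT j n / TT j r) + Real.logb 2 (TT j r) := by
    rw [← Real.logb_mul (by positivity) hr.ne', div_mul_cancel₀ _ hr.ne']
  rw [TT_succ, TT_succ, h3]
  nlinarith

theorem TT_ratio (j : ℕ) {τ : ℝ} (hτ : 0 < τ) (i : ℕ) : ∃ C : ℝ, 0 < C ∧ ∀ r n, r ≤ n →
    TT (j+1+i) n / TT (j+1+i) r ≤ C * (TT j n / TT j r)^τ := by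
  induction i with
  | zero =>
    obtain ⟨C, hC, h⟩ := log_bd hτ
    refine ⟨C, hC, fun r n hrn => ?_⟩
    rw [div_le_iff₀ (TT_pos _ _)]
    refine (TT_ratio_succ j hrn).trans ?_
    apply mul_le_mul_of_nonneg_right _ (TT_pos _ _).le
    exact h _ ((one_le_div (TT_pos _ _)).2 (TT_mono j hrn))
  | succ i ih =>
    obtain ⟨C, hC, h⟩ := ih
    obtain ⟨C1, hC1, h1⟩ := log_bd one_pos
    refine ⟨C1 * C, by positivity, fun r n hrn => ?_⟩
    rw [← add_assoc, div_le_iff₀ (TT_pos _ _)]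
    refine (TT_ratio_succ _ hrn).trans ?_
    apply mul_le_mul_of_nonneg_right _ (TT_pos _ _).le
    refine (h1 _ ((one_le_div (TT_pos _ _)).2 (TT_mono _ hrn))).trans ?_
    rw [Real.rpow_one, mul_assoc]
    exact mul_le_mul_of_nonneg_left (h r n hrn) hC1.le

theorem TT_ratio' (j : ℕ) {τ : ℝ} (hτ : 0 < τ) (i : ℕ) (hi : j < i) : ∃ C : ℝ, 0 < C ∧
    ∀ r n, r ≤ n → TT i n / TT i r ≤ C * (TT j n / TT j r)^τ := by
  obtain ⟨k, rfl⟩ := Nat.exists_eq_add_of_le (Nat.succ_le_of_lt hi)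
  exact TT_ratio j hτ k

/-- lower bound for the growth of `l_η' / l_η` -/
theorem Q_lower {η η' : List ℝ} (hη : ∀ x ∈ η, 0 ≤ x ∧ x < 1) (hη' : ∀ x ∈ η', 0 ≤ x ∧ x < 1)
    {j : ℕ} (hmin : ∀ i < j, η.getD i 0 = η'.getD i 0) {κ : ℝ} (hκ : 0 < κ) :
    ∃ c : ℝ, 0 < c ∧ ∀ r n, r ≤ n →
      c * (TT j n / TT j r)^(η'.getD j 0 - η.getD j 0 - κ) * (LL η' r / LL η r) ≤
        LL η' n / LL η n := by
  set N := max η.length η'.length + j + 1 with hN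
  set τ := κ / N with hτ
  have hNpos : (0:ℝ) < N := by exact_mod_cast (by omega : 0 < N)
  have hτ0 : 0 < τ := by positivity
  -- per-factor bounds
  have hfac : ∀ i, ∃ c : ℝ, 0 < c ∧ ∀ r n, r ≤ n →
      c * (TT j n / TT j r)^((if i = j then η'.getD j 0 - η.getD j 0 else 0) - τ) ≤
        (TT i n / TT i r)^(η'.getD i 0 - η.getD i 0) := by
    intro i
    rcases lt_trichotomy i j with h | h | h
    · refine ⟨1, one_pos, fun r n hrn => ?_⟩
      have hX : 1 ≤ TT j n / TT j r := (one_le_div (TT_pos _ _)).2 (TT_mono j hrn)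
      rw [if_neg h.ne, hmin i h, sub_self, Real.rpow_zero, one_mul]
      exact Real.rpow_le_one_of_one_le_of_nonpos hX (by linarith)
    · subst h
      refine ⟨1, one_pos, fun r n hrn => ?_⟩
      have hX : 1 ≤ TT i n / TT i r := (one_le_div (TT_pos _ _)).2 (TT_mono i hrn)
      rw [if_pos rfl, one_mul]
      exact Real.rpow_le_rpow_of_exponent_le hX (by linarith)
    · obtain ⟨C, hC, hb⟩ := TT_ratio' j hτ0 i h
      refine ⟨C⁻¹, by positivity, fun r n hrn => ?_⟩
      have hX : 1 ≤ TT j n / TT j r := (one_le_div (TT_pos _ _)).2 (TT_mono j hrn)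
      have hY : 1 ≤ TT i n / TT i r := (one_le_div (TT_pos _ _)).2 (TT_mono i hrn)
      have hb' := hb r n hrn
      obtain ⟨a0, a1⟩ := getD_bd hη i
      obtain ⟨b0, b1⟩ := getD_bd hη' i
      rw [if_neg h.ne', zero_sub]
      generalize TT j n / TT j r = X at hX hb'
      generalize TT i n / TT i r = Y at hY hb'
      have hXp : 0 < X := by linarith
      calc C⁻¹ * X^(-τ) = (C * X^τ)⁻¹ := by rw [Real.rpow_neg hXp.le, mul_inv]
        _ ≤ Y⁻¹ := inv_anti₀ (by linarith) hb'
        _ = Y^(-1:ℝ) := (Real.rpow_neg_one Y).symm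
        _ ≤ _ := Real.rpow_le_rpow_of_exponent_le hY (by linarith)
  choose c hc hcb using hfac
  refine ⟨∏ i ∈ Finset.range N, c i, Finset.prod_pos fun i _ => hc i, fun r n hrn => ?_⟩
  have hXp : 0 < TT j n / TT j r := div_pos (TT_pos _ _) (TT_pos _ _)
  have hQ : ∀ m, LL η' m / LL η m = ∏ i ∈ Finset.range N, TT i m ^ (η'.getD i 0 - η.getD i 0) := by
    intro m
    rw [LL_eq η (N := N) (by omega), LL_eq η' (N := N) (by omega), ← Finset.prod_div_distrib]
    exact Finset.prod_congr rfl fun i _ => (Real.rpow_sub (TT_pos _ _) _ _).symm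
  have hprod : ∏ i ∈ Finset.range N,
      (TT j n / TT j r)^((if i = j then η'.getD j 0 - η.getD j 0 else 0) - τ) =
      (TT j n / TT j r)^(η'.getD j 0 - η.getD j 0 - κ) := by
    rw [← Real.rpow_sum_of_pos hXp]
    congr 1
    rw [Finset.sum_sub_distrib, Finset.sum_ite_eq', if_pos (Finset.mem_range.2 (by omega)),
      Finset.sum_const, Finset.card_range, nsmul_eq_mul, hτ, mul_div_cancel₀ _ hNpos.ne']
  rw [hQ, hQ, ← hprod, ← Finset.prod_mul_distrib, ← Finset.prod_mul_distrib]
  apply Finset.prod_le_prod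
  · intro i _
    have := hc i
    have := TT_pos i r
    positivity
  · intro i _
    have h1 := hcb i r n hrn
    have hr := TT_pos i r
    rw [Real.div_rpow (TT_pos _ _).le hr.le, le_div_iff₀ (Real.rpow_pos_of_pos hr _)] at h1
    exact h1

theorem uQ_lower {η η' : List ℝ} (hη : ∀ x ∈ η, 0 ≤ x ∧ x < 1) (hη' : ∀ x ∈ η', 0 ≤ x ∧ x < 1)
    {j : ℕ} (hmin : ∀ i < j, η.getD i 0 = η'.getD i 0) {δ : ℝ}
    (hδ : (2:ℝ)^(η.getD j 0 - η'.getD j 0) < δ) (hδ1 : δ < 1) {I : Set ℕ} {u : ℕ → ℝ}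
    (hu : US j δ I u) :
    ∃ c σ : ℝ, 0 < c ∧ 0 < σ ∧ ∀ r n, r ≤ n →
      c * (TT j n / TT j r)^σ * (u r * (LL η' r / LL η r)) ≤ u n * (LL η' n / LL η n) := by
  have hδ0 : 0 < δ := lt_trans (by positivity) hδ
  set s := - Real.logb 2 δ with hs
  have hs0 : 0 < s := by
    have := Real.logb_neg (by norm_num : (1:ℝ) < 2) hδ0 hδ1
    linarith
  have hδs : δ = (2:ℝ)^(-s) := by
    rw [hs, neg_neg, Real.rpow_logb (by norm_num) (by norm_num) hδ0]
  have hsε : s < η'.getD j 0 - η.getD j 0 := by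
    have := (Real.lt_logb_iff_rpow_lt (by norm_num : (1:ℝ) < 2) hδ0).2 hδ
    linarith
  set σ := (η'.getD j 0 - η.getD j 0 - s) / 2 with hσ
  have hσ0 : 0 < σ := by linarith
  obtain ⟨c, hc, hQ⟩ := Q_lower hη hη' hmin hσ0
  have hj : (0:ℝ) ≤ j := Nat.cast_nonneg j
  refine ⟨c * (2 * (j+2))^(-s), σ, by positivity, hσ0, fun r n hrn => ?_⟩
  have hX : 0 < TT j n / TT j r := div_pos (TT_pos _ _) (TT_pos _ _)
  have h1 := hQ r n hrn
  have hur := (hu.sv hδ0 hδ1).pos r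
  have hQr : 0 < LL η' r / LL η r := div_pos (LL_pos _ _) (LL_pos _ _)
  have h2 : (2:ℝ)^(Dset j I r n).card ≤ 2 * (j+2) * (TT j n / TT j r) := by
    rw [← mul_div_assoc, le_div_iff₀ (TT_pos _ _)]; exact Dset_card j I hrn
  have h3 : (2 * (j+2))^(-s) * (TT j n / TT j r)^(-s) ≤ δ^(Dset j I r n).card := by
    have e1 : δ^(Dset j I r n).card = ((2:ℝ)^(Dset j I r n).card)^(-s) := by
      rw [hδs, ← Real.rpow_natCast, ← Real.rpow_mul (by norm_num), ← Real.rpow_natCast,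
        ← Real.rpow_mul (by norm_num), mul_comm]
    rw [e1, ← Real.mul_rpow (by positivity) hX.le]
    exact Real.rpow_le_rpow_of_nonpos (by positivity) h2 (by linarith)
  rw [hu.ratio hrn]
  generalize TT j n / TT j r = X at *
  have e : X^σ = X^(-s) * X^(η'.getD j 0 - η.getD j 0 - σ) := by
    rw [← Real.rpow_add hX]; congr 1; rw [hσ]; ring
  rw [e]
  calc c * (2 * (j+2))^(-s) * (X^(-s) * X^(η'.getD j 0 - η.getD j 0 - σ)) *
        (u r * (LL η' r / LL η r))
      = ((2 * (j+2))^(-s) * X^(-s)) * u r *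
        (c * X^(η'.getD j 0 - η.getD j 0 - σ) * (LL η' r / LL η r)) := by ring
    _ ≤ (δ^(Dset j I r n).card * u r) * (LL η' n / LL η n) := by
      apply mul_le_mul _ h1 (by positivity) (by positivity)
      exact mul_le_mul_of_nonneg_right h3 hur.le

theorem critA2 {K K' β K0 : ℝ} {w v : ℕ → ℝ} (hw : SV K w) (hv : SV K' v) (hβ : 0 < β)
    (hβ2 : β ≤ 1/2) (hR : ∀ m n, m ≤ n → w m * v n ≤ K0 * (w n * v m)) :
    BorelReducible (EF (St fun n => β^n * w n)) (EF (St fun n => β^n * v n)) :=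
  critA (hw.mono (le_max_left K K')) (hv.mono (le_max_right K K')) hβ hβ2 hR

theorem critB2 {K K' β : ℝ} {w v : ℕ → ℝ} (hw : SV K w) (hv : SV K' v) (hβ : 0 < β)
    (hβ2 : β ≤ 1/2)
    (hR : ∀ ε : ℝ, 0 < ε → ∀ A : ℕ, ∃ r n : ℕ, r ≤ n ∧ (A*(n+1))^A ≤ 2^r ∧
      w n * v r ≤ ε * (w r * v n)) :
    ¬ BorelReducible (EF (St fun n => β^n * w n)) (EF (St fun n => β^n * v n)) :=
  critB (hw.mono (le_max_left K K')) (hv.mono (le_max_right K K')) hβ hβ2 hR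

def Iblk (a : ℕ → ℕ) (U : Set ℕ) : Set ℕ := {m | ∃ l, a l ≤ m ∧ m < a (l+1) ∧ l ∈ U}

theorem mem_Iblk {a : ℕ → ℕ} {U : Set ℕ} {m : ℕ} :
    m ∈ Iblk a U ↔ ∃ l, a l ≤ m ∧ m < a (l+1) ∧ l ∈ U := Iff.rfl

theorem a_strictMono {a : ℕ → ℕ} (haS : ∀ l, a (l+1) = a l + 1 + l * a l) : StrictMono a :=
  strictMono_nat_of_lt_succ fun l => by rw [haS]; omega

theorem blk_unique {a : ℕ → ℕ} (ha : StrictMono a) {l l' m : ℕ} (h1 : a l ≤ m) (h2 : m < a (l+1))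
    (h3 : a l' ≤ m) (h4 : m < a (l'+1)) : l = l' := by
  have := ha.lt_iff_lt.1 (h1.trans_lt h4)
  have := ha.lt_iff_lt.1 (h3.trans_lt h2)
  omega

theorem redA1 {β : ℝ} (hβ : 0 < β) (hβ2 : β ≤ 1/2) {η : List ℝ}
    (hη : ∀ x ∈ η, 0 ≤ x ∧ x < 1) {j : ℕ} {δ : ℝ} (h0 : 0 < δ) (h1 : δ < 1)
    {I J : Set ℕ} {u v : ℕ → ℝ} (hu : US j δ I u) (hv : US j δ J v) {M : ℕ}
    (hIJ : ∀ m ∈ I, M ≤ m → m ∈ J) :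
    BorelReducible (EF (St fun n => β^n * (u n / LL η n)))
      (EF (St fun n => β^n * (v n / LL η n))) := by
  classical
  refine critA2 (K0 := (δ^M)⁻¹) (SV_div hη (hu.sv h0 h1)) (SV_div hη (hv.sv h0 h1)) hβ hβ2 ?_
  intro m n hmn
  have e1 := hu.ratio hmn
  have e2 := hv.ratio hmn
  have hc : (Dset j I m n).card ≤ (Dset j J m n).card + M := by
    have hsub : Dset j I m n ⊆ Dset j J m n ∪ Finset.range M := by
      intro i hi
      rw [mem_Dset] at hi
      rw [Finset.mem_union, mem_Dset, Finset.mem_range]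
      rcases lt_or_ge i M with h | h
      · exact Or.inr h
      · exact Or.inl ⟨hi.1, hi.2.1, hIJ i hi.2.2 h⟩
    have := (Finset.card_le_card hsub).trans (Finset.card_union_le _ _)
    rwa [Finset.card_range] at this
  have hp : δ^(Dset j J m n).card * δ^M ≤ δ^(Dset j I m n).card := by
    rw [← pow_add]; exact pow_le_pow_of_le_one h0.le h1.le hc
  have hp2 : δ^(Dset j J m n).card ≤ (δ^M)⁻¹ * δ^(Dset j I m n).card := by
    rw [inv_mul_eq_div, le_div_iff₀ (by positivity)]; exact hp
  have hum := (hu.sv h0 h1).pos m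
  have hvm := (hv.sv h0 h1).pos m
  have hLm := LL_pos η m
  have hLn := LL_pos η n
  rw [e1, e2]
  calc u m / LL η m * (δ^(Dset j J m n).card * v m / LL η n)
      = δ^(Dset j J m n).card * (u m * v m / (LL η m * LL η n)) := by field_simp
    _ ≤ (δ^M)⁻¹ * δ^(Dset j I m n).card * (u m * v m / (LL η m * LL η n)) :=
        mul_le_mul_of_nonneg_right hp2 (by positivity)
    _ = _ := by field_simp

theorem redB1 {β : ℝ} (hβ : 0 < β) (hβ2 : β ≤ 1/2) {η : List ℝ}
    (hη : ∀ x ∈ η, 0 ≤ x ∧ x < 1) {j : ℕ} {δ : ℝ} (h0 : 0 < δ) (h1 : δ < 1)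
    {I J : Set ℕ} {u v : ℕ → ℝ} (hu : US j δ I u) (hv : US j δ J v)
    (hIJ : ∀ M m0 : ℕ, ∃ m ≥ m0, ∀ i, m - M < i → i ≤ m → i ∈ I ∧ i ∉ J) :
    ¬ BorelReducible (EF (St fun n => β^n * (u n / LL η n)))
      (EF (St fun n => β^n * (v n / LL η n))) := by
  classical
  refine critB2 (SV_div hη (hu.sv h0 h1)) (SV_div hη (hv.sv h0 h1)) hβ hβ2 ?_
  intro ε hε A
  obtain ⟨M, hM⟩ := exists_pow_lt_of_lt_one hε h1
  obtain ⟨m0, hm0⟩ := growth j A M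
  obtain ⟨m, hm, hi⟩ := hIJ M m0
  obtain ⟨hMm, hg⟩ := hm0 m hm
  have hk := kIter_strictMono j
  have hrn : kIter j (m - M) ≤ kIter j m := hk.monotone (by omega)
  refine ⟨kIter j (m - M), kIter j m, hrn, hg, ?_⟩
  have e1 := hu.ratio hrn
  have e2 := hv.ratio hrn
  have hJ : Dset j J (kIter j (m-M)) (kIter j m) = ∅ := by
    apply Finset.eq_empty_of_forall_notMem
    intro i h
    rw [mem_Dset, hk.lt_iff_lt, hk.le_iff_le] at h
    exact (hi i h.1 h.2.1).2 h.2.2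
  have hI : M ≤ (Dset j I (kIter j (m-M)) (kIter j m)).card := by
    have hsub : Finset.Ioc (m-M) m ⊆ Dset j I (kIter j (m-M)) (kIter j m) := by
      intro i h
      rw [Finset.mem_Ioc] at h
      rw [mem_Dset, hk.lt_iff_lt, hk.le_iff_le]
      exact ⟨h.1, h.2, (hi i h.1 h.2).1⟩
    have := Finset.card_le_card hsub
    rw [Nat.card_Ioc] at this
    omega
  rw [hJ, Finset.card_empty, pow_zero, one_mul] at e2
  have hp : δ^(Dset j I (kIter j (m-M)) (kIter j m)).card ≤ ε :=
    (pow_le_pow_of_le_one h0.le h1.le hI).trans hM.le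
  have hum := (hu.sv h0 h1).pos (kIter j (m-M))
  have hvm := (hv.sv h0 h1).pos (kIter j (m-M))
  have hLm := LL_pos η (kIter j (m-M))
  have hLn := LL_pos η (kIter j m)
  rw [e1, e2]
  generalize kIter j (m-M) = r at *
  generalize kIter j m = n at *
  calc δ^(Dset j I r n).card * u r / LL η n * (v r / LL η r)
      = δ^(Dset j I r n).card * (u r * v r / (LL η r * LL η n)) := by field_simp
    _ ≤ ε * (u r * v r / (LL η r * LL η n)) :=
        mul_le_mul_of_nonneg_right hp (by positivity)
    _ = _ := by field_simp

theorem US_one (j : ℕ) (δ : ℝ) : US j δ ∅ (fun _ => 1) where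
  zero := rfl
  step _ _ _ h := absurd h (Set.notMem_empty _)
  const _ _ := rfl

theorem redA2 {β : ℝ} (hβ : 0 < β) (hβ2 : β ≤ 1/2) {η η' : List ℝ}
    (hη : ∀ x ∈ η, 0 ≤ x ∧ x < 1) (hη' : ∀ x ∈ η', 0 ≤ x ∧ x < 1)
    {j : ℕ} (hmin : ∀ i < j, η.getD i 0 = η'.getD i 0) {δ : ℝ}
    (hδ : (2:ℝ)^(η.getD j 0 - η'.getD j 0) < δ) (h1 : δ < 1)
    {I : Set ℕ} {u : ℕ → ℝ} (hu : US j δ I u) :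
    BorelReducible (EF (St fun n => β^n * (u n / LL η n)))
      (EF (St fun n => β^n * (1 / LL η' n))) := by
  have h0 : 0 < δ := lt_trans (by positivity) hδ
  obtain ⟨c, σ, hc, hσ, hQ⟩ := uQ_lower hη hη' hmin hδ h1 hu
  refine critA2 (K0 := c⁻¹) (SV_div hη (hu.sv h0 h1))
    (SV_div hη' ((US_one j δ).sv h0 h1)) hβ hβ2 ?_
  intro m n hmn
  have h := hQ m n hmn
  have hX : 1 ≤ (TT j n / TT j m)^σ := by
    apply Real.one_le_rpow _ hσ.le
    rw [one_le_div (TT_pos _ _)]; exact TT_mono j hmn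
  have hum := (hu.sv h0 h1).pos m
  have a1 := LL_pos η m
  have a2 := LL_pos η n
  have a3 := LL_pos η' m
  have a4 := LL_pos η' n
  have h2 : c * (u m * (LL η' m / LL η m)) ≤ u n * (LL η' n / LL η n) := by
    refine le_trans (mul_le_mul_of_nonneg_right ?_ (by positivity)) h
    exact le_mul_of_one_le_right hc.le hX
  calc u m / LL η m * (1 / LL η' n)
      = c⁻¹ * (1 / (LL η' n * LL η' m)) * (c * (u m * (LL η' m / LL η m))) := by field_simp
    _ ≤ c⁻¹ * (1 / (LL η' n * LL η' m)) * (u n * (LL η' n / LL η n)) :=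
        mul_le_mul_of_nonneg_left h2 (by positivity)
    _ = _ := by field_simp

theorem redB2 {β : ℝ} (hβ : 0 < β) (hβ2 : β ≤ 1/2) {η η' : List ℝ}
    (hη : ∀ x ∈ η, 0 ≤ x ∧ x < 1) (hη' : ∀ x ∈ η', 0 ≤ x ∧ x < 1)
    {j : ℕ} (hmin : ∀ i < j, η.getD i 0 = η'.getD i 0) {δ : ℝ}
    (hδ : (2:ℝ)^(η.getD j 0 - η'.getD j 0) < δ) (h1 : δ < 1)
    {I : Set ℕ} {u : ℕ → ℝ} (hu : US j δ I u) :
    ¬ BorelReducible (EF (St fun n => β^n * (1 / LL η' n)))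
      (EF (St fun n => β^n * (u n / LL η n))) := by
  have h0 : 0 < δ := lt_trans (by positivity) hδ
  have hj : (0:ℝ) ≤ j := Nat.cast_nonneg j
  obtain ⟨c, σ, hc, hσ, hQ⟩ := uQ_lower hη hη' hmin hδ h1 hu
  refine critB2 (SV_div hη' ((US_one j δ).sv h0 h1)) (SV_div hη (hu.sv h0 h1)) hβ hβ2 ?_
  intro ε hε A
  obtain ⟨M, hM⟩ := pow_unbounded_of_one_lt ((j+2) * ((c*ε)⁻¹)^(1/σ)) (by norm_num : (1:ℝ) < 2)
  obtain ⟨m0, hm0⟩ := growth j A M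
  obtain ⟨hMm, hg⟩ := hm0 m0 le_rfl
  have hk := kIter_strictMono j
  have hrn : kIter j (m0 - M) ≤ kIter j m0 := hk.monotone (by omega)
  refine ⟨kIter j (m0 - M), kIter j m0, hrn, hg, ?_⟩
  have h := hQ _ _ hrn
  have hT1 := (TT_kIter j m0).1
  have hT2 := (TT_kIter j (m0 - M)).2
  have hpw : (2:ℝ)^(m0+1) = 2^M * 2^(m0-M+1) := by rw [← pow_add]; congr 1; omega
  have hX0 : (2:ℝ)^M / (j+2) ≤ TT j (kIter j m0) / TT j (kIter j (m0-M)) := by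
    rw [div_le_div_iff₀ (by positivity) (TT_pos _ _)]
    calc (2:ℝ)^M * TT j (kIter j (m0-M)) ≤ 2^M * ((j+2) * 2^(m0-M+1)) :=
          mul_le_mul_of_nonneg_left hT2 (by positivity)
      _ = 2^(m0+1) * (j+2) := by rw [hpw]; ring
      _ ≤ _ := mul_le_mul_of_nonneg_right hT1 (by positivity)
  have hX1 : ((c*ε)⁻¹)^(1/σ) ≤ TT j (kIter j m0) / TT j (kIter j (m0-M)) := by
    refine le_trans ?_ hX0
    rw [le_div_iff₀ (by positivity)]; linarith
  have hX : (c*ε)⁻¹ ≤ (TT j (kIter j m0) / TT j (kIter j (m0-M)))^σ := by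
    have := Real.rpow_le_rpow (by positivity) hX1 hσ.le
    rwa [← Real.rpow_mul (by positivity), one_div_mul_cancel hσ.ne', Real.rpow_one] at this
  generalize kIter j (m0-M) = r at *
  generalize kIter j m0 = n at *
  have hur := (hu.sv h0 h1).pos r
  have a1 := LL_pos η r
  have a2 := LL_pos η n
  have a3 := LL_pos η' r
  have a4 := LL_pos η' n
  have h2 : ε⁻¹ * (u r * (LL η' r / LL η r)) ≤ u n * (LL η' n / LL η n) := by
    refine le_trans (mul_le_mul_of_nonneg_right ?_ (by positivity)) h
    calc ε⁻¹ = c * (c*ε)⁻¹ := by field_simp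
      _ ≤ _ := mul_le_mul_of_nonneg_left hX hc.le
  calc 1 / LL η' n * (u r / LL η r)
      = ε * (1 / (LL η' n * LL η' r)) * (ε⁻¹ * (u r * (LL η' r / LL η r))) := by field_simp
    _ ≤ ε * (1 / (LL η' n * LL η' r)) * (u n * (LL η' n / LL η n)) :=
        mul_le_mul_of_nonneg_left h2 (by positivity)
    _ = _ := by field_simp

theorem stmt19 (α : ℝ) (hα : 1 ≤ α) (η η' : List ℝ)
    (hη : ∀ x ∈ η, 0 ≤ x ∧ x < 1) (hη' : ∀ x ∈ η', 0 ≤ x ∧ x < 1)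
    (j₀ : ℕ) (hj₀lt : η.getD j₀ 0 < η'.getD j₀ 0)
    (hj₀min : ∀ j < j₀, η.getD j 0 = η'.getD j 0)
    (δ : ℝ) (hδlb : (2:ℝ) ^ (η.getD j₀ 0 - η'.getD j₀ 0) < δ) (hδub : δ < 1)
    (a : ℕ → ℕ) (ha0 : a 0 = 0) (haS : ∀ l, a (l+1) = a l + 1 + l * a l)
    (u : Set ℕ → ℕ → ℝ) (hu0 : ∀ U, u U 0 = 1)
    (huk : ∀ (U : Set ℕ) (n m l : ℕ), n + 1 = kIter j₀ m → a l ≤ m → m < a (l+1) →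
      l ∈ U → u U (n+1) = δ * u U n)
    (hunk : ∀ (U : Set ℕ) (n : ℕ),
      (¬ ∃ m l, n + 1 = kIter j₀ m ∧ a l ≤ m ∧ m < a (l+1) ∧ l ∈ U) → u U (n+1) = u U n)
    (φU : Set ℕ → ℝ → ℝ)
    (hφUc : ∀ U, ContinuousOn (φU U) (Icc 0 1))
    (hφUm : ∀ U, MonotoneOn (φU U) (Icc 0 1))
    (hφUnn : ∀ U, ∀ t ∈ Icc (0:ℝ) 1, 0 ≤ φU U t)
    (hφUval : ∀ U (n : ℕ), φU U ((1/2:ℝ)^n) = u U n) :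
    (∀ U V : Set ℕ, (U \ V).Finite ↔
      BorelReducible
        (EF (fun x => if x = 0 then 0 else x ^ α * φU U x / lFun η x))
        (EF (fun x => if x = 0 then 0 else x ^ α * φU V x / lFun η x))) ∧
    (∀ U : Set ℕ,
      BorelReducible (EF (fEta α η))
        (EF (fun x => if x = 0 then 0 else x ^ α * φU U x / lFun η x)) ∧
      BorelReducible
        (EF (fun x => if x = 0 then 0 else x ^ α * φU U x / lFun η x))
        (EF (fEta α η')) ∧
      ¬ BorelReducible (EF (fEta α η'))
        (EF (fun x => if x = 0 then 0 else x ^ α * φU U x / lFun η x))) := by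
  have hδ0 : 0 < δ := lt_trans (by positivity) hδlb
  have hβ : (0:ℝ) < 2^(-α) := by positivity
  have hβ2 : (2:ℝ)^(-α) ≤ 1/2 := by
    calc (2:ℝ)^(-α) ≤ 2^(-1:ℝ) := Real.rpow_le_rpow_of_exponent_le (by norm_num) (by linarith)
      _ = 1/2 := by rw [Real.rpow_neg_one]; norm_num
  have ha := a_strictMono haS
  have hUS : ∀ U, US j₀ δ (Iblk a U) (u U) := by
    intro U
    refine ⟨hu0 U, ?_, ?_⟩
    · rintro n m hnm ⟨l, h1, h2, h3⟩
      exact huk U n m l hnm h1 h2 h3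
    · intro n hn
      apply hunk U n
      rintro ⟨m, l, h⟩
      exact hn ⟨m, h.1, l, h.2⟩
  have hE : ∀ U, EF (fun x => if x = 0 then 0 else x ^ α * φU U x / lFun η x) =
      EF (St fun n => ((2:ℝ)^(-α))^n * (u U n / LL η n)) := fun U =>
    EF_eq hα hη ((hUS U).sv hδ0 hδub) (hφUm U) (hφUnn U) (hφUval U)
  have hF : ∀ ζ : List ℝ, (∀ x ∈ ζ, 0 ≤ x ∧ x < 1) → EF (fEta α ζ) =
      EF (St fun n => ((2:ℝ)^(-α))^n * (1 / LL ζ n)) := by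
    intro ζ hζ
    have h := EF_eq hα hζ ((US_one j₀ δ).sv hδ0 hδub) (φ := fun _ => 1)
      (fun _ _ _ _ _ => le_rfl) (fun _ _ => zero_le_one) (fun _ => rfl)
    rw [← h]
    congr 1
    funext x
    simp only [fEta, mul_one]
  refine ⟨fun U V => ?_, fun U => ⟨?_, ?_, ?_⟩⟩
  · rw [hE U, hE V]
    constructor
    · intro hfin
      obtain ⟨L, hL⟩ := hfin.bddAbove
      refine redA1 hβ hβ2 hη hδ0 hδub (hUS U) (hUS V) (M := a (L+1)) ?_
      rintro m ⟨l, h1, h2, h3⟩ hm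
      refine ⟨l, h1, h2, ?_⟩
      by_contra hlV
      have hl := hL ⟨h3, hlV⟩
      have := ha.monotone (Nat.add_le_add_right hl 1)
      omega
    · intro hred
      by_contra hinf
      refine redB1 hβ hβ2 hη hδ0 hδub (hUS U) (hUS V) ?_ hred
      intro M m0
      obtain ⟨l, hl, hlt⟩ := (show (U \ V).Infinite from hinf).exists_gt (M + m0)
      have hal : l ≤ a l := ha.le_apply
      have hmul : l * 1 ≤ l * a l := Nat.mul_le_mul_left l (by omega)
      have hS := haS l
      refine ⟨a l + l * a l, by omega, fun i h1 h2 => ⟨⟨l, by omega, by omega, hl.1⟩, ?_⟩⟩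
      rintro ⟨l', h3, h4, h5⟩
      have := blk_unique ha (by omega : a l ≤ i) (by omega) h3 h4
      exact hl.2 (this ▸ h5)
  · rw [hE U, hF η hη]
    exact redA1 hβ hβ2 hη hδ0 hδub (US_one j₀ δ) (hUS U) (M := 0)
      (fun m hm => absurd hm (Set.notMem_empty m))
  · rw [hE U, hF η' hη']
    exact redA2 hβ hβ2 hη hη' hj₀min hδlb hδub (hUS U)
  · rw [hE U, hF η' hη']
    exact redB2 hβ hβ2 hη hη' hj₀min hδlb hδub (hUS U)
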